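/- arXiv:math/0410053 — 4 statements merged into one kernel-verified Lean document; each statement's English description precedes it below -/
import Mathlib

section
/- (Amice–Vélu, Vishik) Let r ∈ ℝ≥0 and let d be an integer with r − 1 < d. Then the subspace Pol^d(ℤ_p, L) of locally polynomial functions of local degree at most d is dense in the Banach space C^r(ℤ_p, L). -/
open Filter Topology Classical

noncomputable section

namespace Paper

variable (p : ℕ) [Fact p.Prime]
variable (L : Type) [NontriviallyNormedField L] [NormedAlgebra ℚ_[p] L]

/-- The canonical embedding `ℚ_p → L`. -/
noncomputable def iotaL : ℚ_[p] → L := algebraMap ℚ_[p] L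

/-- The binomial coefficient `binom(z, n) = z(z-1)⋯(z-n+1)/n!` of a `p`-adic
integer, computed in `ℚ_p`. -/
noncomputable def binomQ (z : ℤ_[p]) (n : ℕ) : ℚ_[p] :=
  (∏ i ∈ Finset.range n, ((z : ℚ_[p]) - (i : ℚ_[p]))) / (n.factorial : ℚ_[p])

/-- The Mahler coefficients `a_n(f) = ∑_{i=0}^n (-1)^i binom(n,i) f(n-i)`. -/
noncomputable def mahlerCoeff (f : ℤ_[p] → L) (n : ℕ) : L :=
  ∑ i ∈ Finset.range (n + 1), (-1 : L) ^ i * (n.choose i : L) * f (((n - i : ℕ) : ℤ_[p]))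

/-- `f : ℤ_p → L` is of class `C^r` : the scaled Mahler coefficients
`n^r a_n(f)` tend to `0`, and `f` is the sum of its Mahler expansion. -/
def IsCr (r : ℝ) (f : ℤ_[p] → L) : Prop :=
  Tendsto (fun n : ℕ => (n : ℝ) ^ r * ‖mahlerCoeff p L f n‖) atTop (nhds 0) ∧
  ∀ z : ℤ_[p], HasSum (fun n : ℕ => mahlerCoeff p L f n * iotaL p L (binomQ p z n)) (f z)

/-- The norm `‖f‖_r = sup_n (n+1)^r ‖a_n(f)‖` on `C^r(ℤ_p, L)`. -/
noncomputable def crNorm (r : ℝ) (f : ℤ_[p] → L) : ℝ :=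
  ⨆ n : ℕ, ((n : ℝ) + 1) ^ r * ‖mahlerCoeff p L f n‖

/-- A continuous (= bounded) linear functional on `C^r(ℤ_p, L)`, i.e. a tempered
distribution of order `r`. -/
structure CrDual (r : ℝ) where
  toFun : (ℤ_[p] → L) → L
  map_add' : ∀ f g : ℤ_[p] → L, IsCr p L r f → IsCr p L r g →
    toFun (f + g) = toFun f + toFun g
  map_smul' : ∀ (c : L) (f : ℤ_[p] → L), IsCr p L r f → toFun (c • f) = c * toFun f
  bound' : ∃ C : ℝ, ∀ f : ℤ_[p] → L, IsCr p L r f → ‖toFun f‖ ≤ C * crNorm p L r f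

/-- The function `z ↦ 1_{a + pⁿℤ_p}(z) (z - a)^j`. -/
noncomputable def indPoly (a : ℤ_[p]) (n : ℕ) (j : ℕ) : ℤ_[p] → L := fun z =>
  if ‖z - a‖ ≤ (p : ℝ) ^ (-(n : ℤ)) then (iotaL p L ((z : ℚ_[p]) - (a : ℚ_[p]))) ^ j else 0

/-- The norm `‖μ‖_{r,d} = sup_{a, 0 ≤ j ≤ d, n} p^{n(j-r)} ‖∫_{a+pⁿℤ_p} (z-a)^j dμ‖`. -/
noncomputable def dualNormRD (r : ℝ) (d : ℕ) (μ : CrDual p L r) : ℝ :=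
  ⨆ (a : ℤ_[p]) (j : Fin (d + 1)) (n : ℕ),
    (p : ℝ) ^ ((n : ℝ) * (((j : ℕ) : ℝ) - r)) * ‖μ.toFun (indPoly p L a n j)‖

/-- `f : ℤ_p → L` is locally polynomial of local degree at most `d`. -/
def IsLocPoly (d : ℕ) (f : ℤ_[p] → L) : Prop :=
  ∃ n : ℕ, ∀ a : ℤ_[p], ∃ P : Polynomial L, P.natDegree ≤ d ∧
    ∀ z : ℤ_[p], ‖z - a‖ ≤ (p : ℝ) ^ (-(n : ℤ)) → f z = Polynomial.eval (iotaL p L (z : ℚ_[p])) P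

/-- A linear functional on `Pol^d(ℤ_p, L)`. -/
structure PolDual (d : ℕ) where
  toFun : (ℤ_[p] → L) → L
  map_add' : ∀ f g : ℤ_[p] → L, IsLocPoly p L d f → IsLocPoly p L d g →
    toFun (f + g) = toFun f + toFun g
  map_smul' : ∀ (c : L) (f : ℤ_[p] → L), IsLocPoly p L d f → toFun (c • f) = c * toFun f

section Approximation

open fwdDiff_aux

set_option linter.unusedSectionVars false

/-- Mahler coefficients are iterated forward differences at `0`. -/
lemma mahlerCoeff_eq_fwdDiff (f : ℤ_[p] → L) (n : ℕ) :
    mahlerCoeff p L f n = (fwdDiff 1)^[n] (fun m : ℕ => f m) 0 := by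
  rw [mahlerCoeff, fwdDiff_iter_eq_sum_shift, ← Finset.sum_range_reflect]
  refine Finset.sum_congr rfl fun i hi => ?_
  have hi' : i ≤ n := Nat.lt_succ_iff.mp (Finset.mem_range.mp hi)
  have h1 : n + 1 - 1 - i = n - i := by omega
  have h2 : n - (n - i) = i := by omega
  rw [h1, h2, Nat.choose_symm hi']
  simp [zsmul_eq_mul]

lemma mahlerCoeff_sub (f g : ℤ_[p] → L) (n : ℕ) :
    mahlerCoeff p L (f - g) n = mahlerCoeff p L f n - mahlerCoeff p L g n := by
  simp only [mahlerCoeff, Pi.sub_apply, mul_sub, Finset.sum_sub_distrib]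

variable {L} in
/-- Iterated forward differences with an arbitrary step `q` annihilate a function which agrees with
polynomials of degree less than `K` on residue classes mod `q`. -/
lemma fwdDiff_iter_eq_zero_of_eq_eval {U : ℕ → L} {q K : ℕ}
    (hU : ∀ m : ℕ, ∃ R : Polynomial L, R.natDegree < K ∧
      ∀ i : ℕ, U (m + i * q) = R.eval ((m + i * q : ℕ) : L)) :
    (fwdDiff q)^[K] U = 0 := by
  funext m
  obtain ⟨R, hR, hUR⟩ := hU m
  let S : Polynomial L := R.comp (Polynomial.C (q : L) * Polynomial.X + Polynomial.C (m : L))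
  have hS : S.natDegree < K := by
    refine lt_of_le_of_lt Polynomial.natDegree_comp_le ?_
    refine lt_of_le_of_lt (Nat.mul_le_mul_left _ Polynomial.natDegree_linear_le) ?_
    simpa using hR
  have h0 := congrFun (Polynomial.fwdDiff_iter_eq_zero_of_degree_lt hS) 0
  rw [fwdDiff_iter_eq_sum_shift] at h0 ⊢
  rw [Pi.zero_apply] at h0 ⊢
  rw [← h0]
  refine Finset.sum_congr rfl fun i _ => ?_
  rw [smul_eq_mul, hUR]
  congr 1
  simp only [S, Polynomial.eval_comp]
  congr 1
  simp
  ring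

/-- The polynomial `((1 + X)^(p^h) - 1)^K`, through which the forward difference with step `p^h`
is expressed by the one with step `1`. -/
def stepPoly (h K : ℕ) : Polynomial ℤ := ((1 + Polynomial.X) ^ p ^ h - 1) ^ K

lemma stepPoly_map (h K : ℕ) :
    (stepPoly p h K).map (Int.castRingHom (ZMod p)) = Polynomial.X ^ (p ^ h * K) := by
  simp [stepPoly, add_pow_char_pow, pow_mul]

lemma stepPoly_monic_natDegree (h K : ℕ) :
    (stepPoly p h K).Monic ∧ (stepPoly p h K).natDegree = p ^ h * K := by
  have hp : 0 < p ^ h := pow_pos (Fact.out : p.Prime).pos h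
  have h1 : ((1 + Polynomial.X : Polynomial ℤ) ^ p ^ h).Monic := by
    rw [add_comm]; exact (Polynomial.monic_X_add_C (1 : ℤ)).pow _
  have hd : ((1 + Polynomial.X : Polynomial ℤ) ^ p ^ h).natDegree = p ^ h := by
    rw [add_comm, ← Polynomial.C_1, (Polynomial.monic_X_add_C (1 : ℤ)).natDegree_pow,
      Polynomial.natDegree_X_add_C, mul_one]
  have hlt : (1 : Polynomial ℤ).degree < ((1 + Polynomial.X : Polynomial ℤ) ^ p ^ h).degree := by
    rw [Polynomial.degree_one, Polynomial.degree_eq_natDegree h1.ne_zero, hd]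
    exact_mod_cast hp
  have h2 : ((1 + Polynomial.X : Polynomial ℤ) ^ p ^ h - 1).Monic := h1.sub_of_left hlt
  refine ⟨h2.pow K, ?_⟩
  rw [stepPoly, h2.natDegree_pow, Polynomial.natDegree_sub_eq_left_of_natDegree_lt, hd, mul_comm]
  rw [hd]; simpa using hp

lemma dvd_stepPoly_coeff {h K i : ℕ} (hi : i < p ^ h * K) :
    (p : ℤ) ∣ (stepPoly p h K).coeff i := by
  have := congrArg (fun P => Polynomial.coeff P i) (stepPoly_map p h K)
  simp only [Polynomial.coeff_map, Polynomial.coeff_X_pow, if_neg hi.ne] at this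
  exact (ZMod.intCast_zmod_eq_zero_iff_dvd _ _).mp this

variable {L} in
lemma aeval_stepPoly (h K : ℕ) (U : ℕ → L) :
    Polynomial.aeval (fwdDiffₗ ℕ L 1) (stepPoly p h K) U = (fwdDiff (p ^ h))^[K] U := by
  have hs : (1 + fwdDiffₗ ℕ L 1) ^ p ^ h - 1 = fwdDiffₗ ℕ L (p ^ h) := by
    ext V m
    have := shiftₗ_pow_apply 1 V (p ^ h) m
    rw [shiftₗ, add_comm] at this
    simp [this, fwdDiff]
  simp only [stepPoly, map_pow, map_sub, map_add, map_one, Polynomial.aeval_X, hs]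
  rw [coe_fwdDiffₗ_pow]

variable {p L} in
/-- If the `K`-th forward difference with step `p^h` of `U` vanishes, its higher forward differences
satisfy a linear recurrence of length `p^h * K` with coefficients divisible by `p`. -/
lemma fwdDiff_iter_recurrence {h K : ℕ} {U : ℕ → L} (hU : (fwdDiff (p ^ h))^[K] U = 0) (n : ℕ) :
    (fwdDiff 1)^[n + p ^ h * K] U 0 =
      -∑ i ∈ Finset.range (p ^ h * K), ((stepPoly p h K).coeff i : L) * (fwdDiff 1)^[n + i] U 0 := by
  obtain ⟨hm, hdeg⟩ := stepPoly_monic_natDegree p h K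
  have h1 : (fwdDiffₗ ℕ L 1 ^ n) (Polynomial.aeval (fwdDiffₗ ℕ L 1) (stepPoly p h K) U) 0 = 0 := by
    rw [aeval_stepPoly, hU, map_zero]; rfl
  have hc : (stepPoly p h K).coeff (p ^ h * K) = 1 := by
    rw [← hdeg]; exact hm
  rw [Polynomial.aeval_eq_sum_range, hdeg, Finset.sum_range_succ, hc, one_smul,
    LinearMap.add_apply, map_add, LinearMap.sum_apply, map_sum, Pi.add_apply, Finset.sum_apply,
    ← Module.End.mul_apply, ← pow_add] at h1
  simp only [← coe_fwdDiffₗ_pow]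
  rw [eq_neg_iff_add_eq_zero, add_comm, ← h1]
  congr 1
  refine Finset.sum_congr rfl fun i _ => ?_
  rw [LinearMap.smul_apply, map_smul, ← Module.End.mul_apply, ← pow_add,
    Pi.smul_apply, zsmul_eq_mul]

variable {L} in
lemma norm_fwdDiff_iter_le [IsUltrametricDist L] {U : ℕ → L} {M : ℝ} (hM : ∀ m, ‖U m‖ ≤ M)
    (n m : ℕ) : ‖(fwdDiff 1)^[n] U m‖ ≤ M := by
  have h0 : 0 ≤ M := (norm_nonneg _).trans (hM 0)
  rw [fwdDiff_iter_eq_sum_shift]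
  refine IsUltrametricDist.norm_sum_le_of_forall_le_of_nonneg h0 fun i _ => ?_
  rw [zsmul_eq_mul, norm_mul]
  exact (mul_le_of_le_one_left (norm_nonneg _)
    (IsUltrametricDist.norm_intCast_le_one L _)).trans (hM _)

lemma norm_prime_cast : ‖(p : L)‖ = (p : ℝ)⁻¹ := by
  rw [← map_natCast (algebraMap ℚ_[p] L), norm_algebraMap', Padic.norm_p]

variable {p L} in
lemma norm_stepPoly_coeff_le [IsUltrametricDist L] {h K i : ℕ} (hi : i < p ^ h * K) :
    ‖((stepPoly p h K).coeff i : L)‖ ≤ (p : ℝ)⁻¹ := by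
  obtain ⟨c, hc⟩ := dvd_stepPoly_coeff p hi
  rw [hc, Int.cast_mul, norm_mul, Int.cast_natCast, norm_prime_cast p L]
  exact mul_le_of_le_one_right (by positivity) (IsUltrametricDist.norm_intCast_le_one L _)

variable {p L} in
/-- Geometric decay of the forward differences of a function that is polynomial of degree less than
`K` on residue classes mod `p^h`. -/
lemma norm_fwdDiff_iter_le_of_step [IsUltrametricDist L] {h K : ℕ} {U : ℕ → L} {M : ℝ}
    (hU : (fwdDiff (p ^ h))^[K] U = 0) (hM : ∀ m, ‖U m‖ ≤ M) (k n : ℕ) (hn : k * (p ^ h * K) ≤ n) :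
    ‖(fwdDiff 1)^[n] U 0‖ ≤ M * (p : ℝ)⁻¹ ^ k := by
  have h0 : 0 ≤ M := (norm_nonneg _).trans (hM 0)
  induction k generalizing n with
  | zero => simpa using norm_fwdDiff_iter_le hM n 0
  | succ k ih =>
    rw [add_mul, one_mul] at hn
    obtain ⟨m, rfl⟩ := Nat.exists_eq_add_of_le' ((Nat.le_add_left _ _).trans hn)
    rw [fwdDiff_iter_recurrence hU, norm_neg]
    refine IsUltrametricDist.norm_sum_le_of_forall_le_of_nonneg (by positivity) fun i hi => ?_
    rw [norm_mul, pow_succ, ← mul_assoc, mul_comm]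
    exact mul_le_mul (ih _ (by omega)) (norm_stepPoly_coeff_le (Finset.mem_range.mp hi))
      (norm_nonneg _) (by positivity)

/-- `(k + 1)^r p^{-k}` is bounded in `k`. -/
lemma exists_rpow_mul_pow_le (r : ℝ) :
    ∃ C : ℝ, 0 < C ∧ ∀ k : ℕ, ((k : ℝ) + 1) ^ r * (p : ℝ)⁻¹ ^ k ≤ C := by
  have hp1 : (1 : ℝ) < p := by exact_mod_cast (Fact.out : p.Prime).one_lt
  obtain ⟨s, hs⟩ := exists_nat_ge r
  have ht := tendsto_pow_const_mul_const_pow_of_abs_lt_one s (r := (p : ℝ)⁻¹)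
    (by rw [abs_of_pos (by positivity)]; exact inv_lt_one_of_one_lt₀ hp1)
  obtain ⟨B, hB⟩ := ((tendsto_add_atTop_iff_nat 1).mpr ht).bddAbove_range
  have hB' : ∀ k : ℕ, ((k : ℝ) + 1) ^ s * (p : ℝ)⁻¹ ^ (k + 1) ≤ B := fun k => by
    simpa using hB ⟨k, rfl⟩
  have hB0 : 0 < B := lt_of_lt_of_le (by positivity) (hB' 0)
  refine ⟨B * p, by positivity, fun k => ?_⟩
  have h1 : ((k : ℝ) + 1) ^ r ≤ ((k : ℝ) + 1) ^ s := by
    rw [← Real.rpow_natCast]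
    exact Real.rpow_le_rpow_of_exponent_le (by linarith [k.cast_nonneg (α := ℝ)]) hs
  calc ((k : ℝ) + 1) ^ r * (p : ℝ)⁻¹ ^ k
      ≤ ((k : ℝ) + 1) ^ s * (p : ℝ)⁻¹ ^ k := by gcongr
    _ = ((k : ℝ) + 1) ^ s * (p : ℝ)⁻¹ ^ (k + 1) * p := by
        rw [pow_succ]; field_simp
    _ ≤ B * p := by gcongr; exact hB' k

/-- The Taylor polynomial of `P` of degree `d` at `a`. -/
def taylorTrunc (d : ℕ) (P : Polynomial L) (a : L) : Polynomial L :=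
  ∑ j ∈ Finset.range (d + 1),
    Polynomial.C ((Polynomial.taylor a P).coeff j) * (Polynomial.X - Polynomial.C a) ^ j

variable {L}

lemma natDegree_taylorTrunc_le (d : ℕ) (P : Polynomial L) (a : L) :
    (taylorTrunc L d P a).natDegree ≤ d := by
  refine Polynomial.natDegree_sum_le_of_forall_le _ _ fun j hj => ?_
  refine (Polynomial.natDegree_C_mul_le _ _).trans ?_
  rw [Polynomial.natDegree_pow, Polynomial.natDegree_X_sub_C, mul_one]
  exact Nat.lt_succ_iff.mp (Finset.mem_range.mp hj)

/-- On the unit ball a polynomial is bounded by the sum of the norms of its coefficients. -/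
lemma norm_eval_le_sum (Q : Polynomial L) {a : L} (ha : ‖a‖ ≤ 1) :
    ‖Q.eval a‖ ≤ ∑ i ∈ Finset.range (Q.natDegree + 1), ‖Q.coeff i‖ := by
  rw [Polynomial.eval_eq_sum_range]
  refine (norm_sum_le _ _).trans (Finset.sum_le_sum fun i _ => ?_)
  rw [norm_mul, norm_pow]
  exact mul_le_of_le_one_right (norm_nonneg _) (pow_le_one₀ (norm_nonneg _) ha)

/-- Uniform estimate of the Taylor remainder on the unit ball. -/
lemma exists_norm_eval_sub_taylorTrunc_le (d : ℕ) (P : Polynomial L) :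
    ∃ B : ℝ, 0 ≤ B ∧ ∀ a z : L, ‖a‖ ≤ 1 → ‖z - a‖ ≤ 1 →
      ‖P.eval z - (taylorTrunc L d P a).eval z‖ ≤ B * ‖z - a‖ ^ (d + 1) := by
  let c : ℕ → ℝ := fun j => ∑ i ∈ Finset.range ((Polynomial.hasseDeriv j P).natDegree + 1),
    ‖(Polynomial.hasseDeriv j P).coeff i‖
  have hc : ∀ j, 0 ≤ c j := fun j => Finset.sum_nonneg fun _ _ => norm_nonneg _
  refine ⟨∑ j ∈ Finset.range (P.natDegree + 1), c (d + 1 + j),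
    Finset.sum_nonneg fun _ _ => hc _, fun a z ha hz => ?_⟩
  have hP : P.eval z = ∑ j ∈ Finset.range (d + 1 + (P.natDegree + 1)),
      (Polynomial.taylor a P).coeff j * (z - a) ^ j := by
    rw [← Polynomial.taylor_eval_sub a,
      Polynomial.eval_eq_sum_range' (n := d + 1 + (P.natDegree + 1))]
    rw [Polynomial.natDegree_taylor]; omega
  have hT : (taylorTrunc L d P a).eval z = ∑ j ∈ Finset.range (d + 1),
      (Polynomial.taylor a P).coeff j * (z - a) ^ j := by
    simp [taylorTrunc, Polynomial.eval_finsetSum]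
  rw [hP, hT, Finset.sum_range_add, add_sub_cancel_left, Finset.sum_mul]
  refine (norm_sum_le _ _).trans (Finset.sum_le_sum fun j _ => ?_)
  rw [norm_mul, norm_pow, Polynomial.taylor_coeff]
  exact mul_le_mul (norm_eval_le_sum _ ha)
    (pow_le_pow_of_le_one (norm_nonneg _) hz (Nat.le_add_right _ _)) (by positivity) (hc _)

variable {p}

lemma toZModPow_eq_of_norm_le {x y : ℤ_[p]} {h : ℕ} (hxy : ‖x - y‖ ≤ (p : ℝ) ^ (-(h : ℤ))) :
    PadicInt.toZModPow h x = PadicInt.toZModPow h y := by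
  rw [PadicInt.norm_le_pow_iff_mem_span_pow, ← PadicInt.ker_toZModPow, RingHom.mem_ker, map_sub,
    sub_eq_zero] at hxy
  exact hxy

lemma norm_sub_toZModPow_val_le (z : ℤ_[p]) (h : ℕ) :
    ‖z - ((PadicInt.toZModPow h z).val : ℤ_[p])‖ ≤ (p : ℝ) ^ (-(h : ℤ)) := by
  rw [PadicInt.norm_le_pow_iff_mem_span_pow, ← PadicInt.ker_toZModPow, RingHom.mem_ker, map_sub,
    map_natCast, ZMod.natCast_zmod_val, sub_self]

/-- The function given on each residue class mod `p^h` by the Taylor polynomial of `P` of degree `d`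
at a natural number in the class. -/
def locTaylor (d h : ℕ) (P : Polynomial L) : ℤ_[p] → L := fun z =>
  (taylorTrunc L d P ((PadicInt.toZModPow h z).val : L)).eval (iotaL p L (z : ℚ_[p]))

lemma isLocPoly_locTaylor (d h : ℕ) (P : Polynomial L) :
    IsLocPoly p L d (locTaylor d h P) := by
  refine ⟨h, fun a => ⟨_, natDegree_taylorTrunc_le d P ((PadicInt.toZModPow h a).val : L),
    fun z hz => ?_⟩⟩
  rw [locTaylor, toZModPow_eq_of_norm_le hz]

lemma iotaL_natCast (m : ℕ) : iotaL p L (((m : ℕ) : ℤ_[p]) : ℚ_[p]) = (m : L) := by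
  simp [iotaL]

/-- The error of the local Taylor approximation of a polynomial is arbitrarily small in the `C^r`
norm for suitable residue classes. -/
lemma exists_locTaylor_approx [IsUltrametricDist L] {r : ℝ} (hr : 0 ≤ r) {d : ℕ}
    (hd : r - 1 < (d : ℝ)) (P : Polynomial L) {ε : ℝ} (hε : 0 < ε) :
    ∃ h : ℕ, ∀ n : ℕ, ((n : ℝ) + 1) ^ r *
      ‖mahlerCoeff p L ((fun z : ℤ_[p] => P.eval (iotaL p L (z : ℚ_[p]))) - locTaylor d h P) n‖ ≤ ε := by
  have hp1 : (1 : ℝ) < p := by exact_mod_cast (Fact.out : p.Prime).one_lt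
  have hp0 : (0 : ℝ) < p := by linarith
  obtain ⟨C, hC0, hC⟩ := exists_rpow_mul_pow_le p r
  obtain ⟨B, hB0, hB⟩ := exists_norm_eval_sub_taylorTrunc_le d P
  let K : ℕ := max P.natDegree d + 1
  have hlim : Tendsto (fun h : ℕ => (K : ℝ) ^ r * C * B * ((p : ℝ) ^ (r - (d + 1))) ^ h)
      atTop (nhds 0) := by
    rw [← mul_zero ((K : ℝ) ^ r * C * B)]
    refine (tendsto_pow_atTop_nhds_zero_of_lt_one (by positivity) ?_).const_mul _
    exact Real.rpow_lt_one_of_one_lt_of_neg hp1 (by linarith)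
  obtain ⟨h, hh⟩ := (hlim.eventually (gt_mem_nhds hε)).exists
  refine ⟨h, fun n => le_trans ?_ hh.le⟩
  let U : ℕ → L := fun m => P.eval (m : L) -
    (taylorTrunc L d P ((PadicInt.toZModPow h (m : ℤ_[p])).val : L)).eval (m : L)
  have hcoeff : mahlerCoeff p L ((fun z : ℤ_[p] => P.eval (iotaL p L (z : ℚ_[p]))) - locTaylor d h P) n =
      (fwdDiff 1)^[n] U 0 := by
    rw [mahlerCoeff_eq_fwdDiff]
    simp only [Pi.sub_apply, locTaylor, iotaL_natCast, U]
  have hstep : (fwdDiff (p ^ h))^[K] U = 0 := by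
    refine fwdDiff_iter_eq_zero_of_eq_eval fun m =>
      ⟨P - taylorTrunc L d P ((PadicInt.toZModPow h (m : ℤ_[p])).val : L), ?_, fun i => ?_⟩
    · refine Nat.lt_succ_of_le ((Polynomial.natDegree_sub_le _ _).trans ?_)
      exact max_le_max le_rfl (natDegree_taylorTrunc_le _ _ _)
    · have : PadicInt.toZModPow h ((m + i * p ^ h : ℕ) : ℤ_[p]) =
          PadicInt.toZModPow h (m : ℤ_[p]) := by
        rw [map_natCast, map_natCast, Nat.cast_add, Nat.cast_mul, ZMod.natCast_self, mul_zero,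
          add_zero]
      simp only [U, this, Polynomial.eval_sub]
  have hbound : ∀ m, ‖U m‖ ≤ B * ((p : ℝ)⁻¹ ^ h) ^ (d + 1) := fun m => by
    have hle := norm_sub_toZModPow_val_le (m : ℤ_[p]) h
    set a := (PadicInt.toZModPow h (m : ℤ_[p])).val with ha
    have hnorm : ‖(m : L) - (a : L)‖ ≤ (p : ℝ)⁻¹ ^ h := by
      rw [← map_natCast (algebraMap ℚ_[p] L) m, ← map_natCast (algebraMap ℚ_[p] L) a, ← map_sub,
        norm_algebraMap']
      rw [zpow_neg, zpow_natCast, ← inv_pow, PadicInt.norm_def] at hle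
      simpa using hle
    have hone : (p : ℝ)⁻¹ ^ h ≤ 1 := pow_le_one₀ (by positivity) (inv_le_one_of_one_le₀ hp1.le)
    refine (hB a m (IsUltrametricDist.norm_natCast_le_one L _) (hnorm.trans hone)).trans ?_
    gcongr
  have hQ : 0 < p ^ h * K := Nat.mul_pos (pow_pos (Fact.out : p.Prime).pos h) (Nat.succ_pos _)
  set k := n / (p ^ h * K) with hk
  have hdecay := norm_fwdDiff_iter_le_of_step hstep hbound k n (Nat.div_mul_le_self _ _)
  have hn : (n : ℝ) + 1 ≤ ((p : ℝ) ^ h * K) * (k + 1) := by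
    exact_mod_cast Nat.succ_le_of_lt (Nat.lt_mul_div_succ n hQ)
  rw [hcoeff]
  calc ((n : ℝ) + 1) ^ r * ‖(fwdDiff 1)^[n] U 0‖
      ≤ (((p : ℝ) ^ h * K) * (k + 1)) ^ r *
          (B * ((p : ℝ)⁻¹ ^ h) ^ (d + 1) * (p : ℝ)⁻¹ ^ k) := by gcongr
    _ = (K : ℝ) ^ r * (((k : ℝ) + 1) ^ r * (p : ℝ)⁻¹ ^ k) * B *
          (((p : ℝ) ^ h) ^ r * ((p : ℝ)⁻¹ ^ h) ^ (d + 1)) := by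
        rw [Real.mul_rpow (by positivity) (by positivity),
          Real.mul_rpow (by positivity) (by positivity)]
        ring
    _ = (K : ℝ) ^ r * (((k : ℝ) + 1) ^ r * (p : ℝ)⁻¹ ^ k) * B *
          ((p : ℝ) ^ (r - (d + 1))) ^ h := by
        congr 1
        rw [Real.rpow_sub hp0, div_pow, ← Real.rpow_natCast, ← Real.rpow_mul hp0.le,
          ← Real.rpow_natCast (_ ^ r), ← Real.rpow_mul hp0.le, mul_comm r, div_eq_mul_inv]
        congr 1
        rw [inv_pow, inv_pow, pow_right_comm]
        norm_cast
    _ ≤ (K : ℝ) ^ r * C * B * ((p : ℝ) ^ (r - (d + 1))) ^ h := by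
        gcongr
        exact hC k

/-- A polynomial with the same first `N` Mahler coefficients as `f`, the others being zero. -/
lemma exists_polynomial_mahlerCoeff (f : ℤ_[p] → L) (N : ℕ) :
    ∃ P : Polynomial L, ∀ n, mahlerCoeff p L (fun z : ℤ_[p] => P.eval (iotaL p L (z : ℚ_[p]))) n =
      if n < N then mahlerCoeff p L f n else 0 := by
  have : CharZero L := charZero_of_injective_algebraMap (algebraMap ℚ_[p] L).injective
  have hinj : Set.InjOn (fun i : ℕ => (i : L)) (Finset.range N) := Nat.cast_injective.injOn
  let P := Lagrange.interpolate (Finset.range N) (fun i : ℕ => (i : L)) (fun i => f i)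
  have hval : ∀ i < N, P.eval (i : L) = f i := fun i hi =>
    Lagrange.eval_interpolate_at_node (fun i : ℕ => f i) hinj (Finset.mem_range.mpr hi)
  refine ⟨P, fun n => ?_⟩
  split_ifs with hn
  · refine Finset.sum_congr rfl fun i _ => ?_
    simp only [iotaL_natCast]
    rw [hval _ (lt_of_le_of_lt (Nat.sub_le _ _) hn)]
  · have hdeg : P.degree < n := by
      refine lt_of_lt_of_le (Lagrange.degree_interpolate_lt _ hinj) ?_
      rw [Finset.card_range]
      exact_mod_cast not_lt.mp hn
    rw [mahlerCoeff_eq_fwdDiff]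
    simp only [iotaL_natCast]
    by_cases hP : P = 0
    · simp [hP, fwdDiff_iter_eq_sum_shift]
    · have := congrFun (Polynomial.fwdDiff_iter_eq_zero_of_degree_lt
        ((Polynomial.natDegree_lt_iff_degree_lt hP).mpr hdeg)) 0
      rw [fwdDiff_iter_eq_sum_shift] at this ⊢
      simpa using this

end Approximation

/-- **Amice–Vélu, Vishik.** If `r ∈ ℝ≥0` and `d` is an integer with `r - 1 < d`,
then `Pol^d(ℤ_p, L)` is dense in the Banach space `C^r(ℤ_p, L)`. -/
theorem statement0 (p : ℕ) [Fact p.Prime] (L : Type) [NontriviallyNormedField L]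
    [NormedAlgebra ℚ_[p] L] [FiniteDimensional ℚ_[p] L] [IsUltrametricDist L]
    (r : ℝ) (hr : 0 ≤ r) (d : ℕ) (hd : r - 1 < (d : ℝ))
    (f : ℤ_[p] → L) (hf : IsCr p L r f) :
    ∀ ε : ℝ, 0 < ε → ∃ g : ℤ_[p] → L,
      IsLocPoly p L d g ∧ crNorm p L r (f - g) < ε := by
  intro ε hε
  have hlim : Tendsto (fun n : ℕ => ((n : ℝ) + 1) ^ r * ‖mahlerCoeff p L f n‖) atTop (nhds 0) := by
    refine squeeze_zero' (.of_forall fun n => by positivity) ?_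
      (by simpa using hf.1.const_mul ((2 : ℝ) ^ r))
    filter_upwards [eventually_ge_atTop 1] with n hn
    have hn' : (1 : ℝ) ≤ n := by exact_mod_cast hn
    rw [← mul_assoc, ← Real.mul_rpow (by norm_num) (by positivity)]
    gcongr
    linarith
  obtain ⟨N, hN⟩ := eventually_atTop.mp (hlim.eventually (gt_mem_nhds (by positivity : 0 < ε / 4)))
  obtain ⟨P, hP⟩ := exists_polynomial_mahlerCoeff f N
  obtain ⟨h, hh⟩ := exists_locTaylor_approx (p := p) hr hd P (by positivity : 0 < ε / 4)
  refine ⟨locTaylor d h P, isLocPoly_locTaylor d h P, ?_⟩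
  refine lt_of_le_of_lt (ciSup_le fun n => ?_) (half_lt_self hε)
  have hsplit : mahlerCoeff p L (f - locTaylor d h P) n =
      (if n < N then 0 else mahlerCoeff p L f n) +
      mahlerCoeff p L ((fun z : ℤ_[p] => P.eval (iotaL p L (z : ℚ_[p]))) - locTaylor d h P) n := by
    rw [mahlerCoeff_sub, mahlerCoeff_sub, hP]
    split_ifs <;> ring
  have htail : ((n : ℝ) + 1) ^ r * ‖if n < N then 0 else mahlerCoeff p L f n‖ ≤ ε / 4 := by
    split_ifs with hn
    · simp only [norm_zero, mul_zero]; positivity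
    · exact (hN n (not_lt.mp hn)).le
  rw [hsplit]
  calc _ ≤ ((n : ℝ) + 1) ^ r * (‖if n < N then 0 else mahlerCoeff p L f n‖ +
        ‖mahlerCoeff p L ((fun z : ℤ_[p] => P.eval (iotaL p L (z : ℚ_[p]))) - locTaylor d h P) n‖) := by
        gcongr
        exact norm_add_le _ _
    _ ≤ ε / 2 := by rw [mul_add]; linarith [hh n]

end Paper

end
end

section
/- (Amice–Vélu, Vishik) Let r ∈ ℝ≥0, let d be an integer with r − 1 < d, and let μ be a linear functional on Pol^d(ℤ_p, L). Then μ extends to a continuous linear functional on C^r(ℤ_p, L) if and only if there is a constant C ∈ ℝ≥0 such that |∫_{a+p^nℤ_p} (z−a)^j dμ(z)| ≤ C · p^{n(r−j)} for all a ∈ ℤ_p, all j ∈ {0,…,d} and all n ∈ ℕ. -/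
open Filter Topology Classical

noncomputable section

namespace Paper

variable (p : ℕ) [Fact p.Prime]
variable (L : Type) [NontriviallyNormedField L] [NormedAlgebra ℚ_[p] L]

open scoped fwdDiff

set_option linter.unusedSectionVars false

section

variable {p L}

lemma norm_iotaL (x : ℚ_[p]) : ‖iotaL p L x‖ = ‖x‖ := norm_algebraMap' L x

lemma norm_natCast_prime_pow (n : ℕ) : ‖((p : L) ^ n)‖ = ((p : ℝ) ^ n)⁻¹ := by
  rw [norm_pow, ← map_natCast (algebraMap ℚ_[p] L) p, norm_algebraMap', Padic.norm_p, inv_pow]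

lemma natCast_prime_pow_ne_zero (n : ℕ) : ((p : L) ^ n) ≠ 0 := by
  rw [← norm_pos_iff, norm_natCast_prime_pow]
  have := (Fact.out : p.Prime).pos
  positivity

lemma charZero_of_normedAlgebra_padic (p : ℕ) [Fact p.Prime] (L : Type)
    [NontriviallyNormedField L] [NormedAlgebra ℚ_[p] L] : CharZero L :=
  charZero_of_injective_algebraMap (algebraMap ℚ_[p] L).injective

/-- The inequality `|k| ≥ 1 / k` for a positive natural number `k`. -/
lemma one_le_natCast_mul_norm (p : ℕ) [Fact p.Prime] {L : Type} [NontriviallyNormedField L]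
    [NormedAlgebra ℚ_[p] L] {k : ℕ} (hk : k ≠ 0) : 1 ≤ (k : ℝ) * ‖(k : L)‖ := by
  have hp := (Fact.out : p.Prime)
  rw [← map_natCast (algebraMap ℚ_[p] L) k, norm_algebraMap',
    Padic.norm_eq_zpow_neg_valuation (by exact_mod_cast hk), Padic.valuation_natCast, zpow_neg,
    zpow_natCast, ← div_eq_mul_inv, one_le_div (by have := hp.pos; positivity)]
  exact_mod_cast Nat.le_of_dvd (Nat.pos_of_ne_zero hk) pow_padicValNat_dvd

section fwdDiff

variable [IsUltrametricDist L]

lemma norm_nsmul_le_norm (k : ℕ) (x : L) : ‖k • x‖ ≤ ‖x‖ := by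
  rw [nsmul_eq_mul, norm_mul]
  exact mul_le_of_le_one_left (norm_nonneg _) (IsUltrametricDist.norm_natCast_le_one L k)

lemma norm_fwdDiff_iter_le_s1 {M : Type*} [AddCommMonoid M] {h : M} {f : M → L} {B : ℝ} (y : M)
    (hf : ∀ k : ℕ, ‖f (y + k • h)‖ ≤ B) (n : ℕ) : ‖Δ_[h] ^[n] f y‖ ≤ B := by
  rw [fwdDiff_iter_eq_sum_shift]
  refine IsUltrametricDist.norm_sum_le_of_forall_le_of_nonneg
    ((norm_nonneg _).trans (hf 0)) fun k _ => ?_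
  rw [zsmul_eq_mul, norm_mul]
  exact (mul_le_of_le_one_left (norm_nonneg _)
    (IsUltrametricDist.norm_intCast_le_one L _)).trans (hf k)

lemma norm_le_of_norm_fwdDiff_iter_le {M : Type*} [AddCommMonoid M] {h : M} {f : M → L} {B : ℝ}
    (y : M) (hf : ∀ k : ℕ, ‖Δ_[h] ^[k] f y‖ ≤ B) (n : ℕ) : ‖f (y + n • h)‖ ≤ B := by
  rw [shift_eq_sum_fwdDiff_iter h f n y]
  exact IsUltrametricDist.norm_sum_le_of_forall_le_of_nonneg
    ((norm_nonneg _).trans (hf 0)) fun k _ => (norm_nsmul_le_norm _ _).trans (hf k)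

lemma norm_natCast_le_of_norm_fwdDiff_iter_le {f : ℤ_[p] → L} {B : ℝ}
    (hf : ∀ k : ℕ, ‖Δ_[1] ^[k] f 0‖ ≤ B) (n : ℕ) : ‖f n‖ ≤ B := by
  simpa using norm_le_of_norm_fwdDiff_iter_le (0 : ℤ_[p]) hf n

lemma norm_choose_prime_pow_le (n k : ℕ) :
    ‖((p ^ n).choose (k + 1) : L)‖ ≤ ((k + 1 : ℕ) : ℝ) / (p : ℝ) ^ n := by
  have hp := (Fact.out : p.Prime).pos
  have hq : 0 < p ^ n := by positivity
  have h := Nat.add_one_mul_choose_eq (p ^ n - 1) k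
  rw [Nat.sub_add_cancel hq] at h
  have h2 : ‖((p ^ n).choose (k + 1) : L)‖ * ‖((k + 1 : ℕ) : L)‖ ≤ ((p : ℝ) ^ n)⁻¹ := by
    rw [← norm_mul, ← Nat.cast_mul, ← h, Nat.cast_mul, norm_mul, Nat.cast_pow,
      norm_natCast_prime_pow]
    exact mul_le_of_le_one_right (by positivity) (IsUltrametricDist.norm_natCast_le_one L _)
  have h3 := one_le_natCast_mul_norm p (L := L) k.succ_ne_zero
  calc _ ≤ ‖((p ^ n).choose (k + 1) : L)‖ * (((k + 1 : ℕ) : ℝ) * ‖((k + 1 : ℕ) : L)‖) :=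
        le_mul_of_one_le_right (norm_nonneg _) h3
    _ = ((k + 1 : ℕ) : ℝ) * (‖((p ^ n).choose (k + 1) : L)‖ * ‖((k + 1 : ℕ) : L)‖) := by ring
    _ ≤ _ := by rw [div_eq_mul_inv]; gcongr

end fwdDiff

lemma mahlerCoeff_eq_fwdDiff_iter (f : ℤ_[p] → L) (n : ℕ) :
    mahlerCoeff p L f n = Δ_[1] ^[n] f 0 := by
  rw [fwdDiff_iter_eq_sum_shift, mahlerCoeff, ← Finset.sum_range_reflect]
  refine Finset.sum_congr rfl fun i hi => ?_
  have hi : i ≤ n := by simpa [Nat.lt_succ_iff] using hi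
  have h1 : n + 1 - 1 - i = n - i := by omega
  rw [h1, Nat.choose_symm hi, Nat.sub_sub_self hi, zsmul_eq_mul]
  simp

lemma fwdDiff_iter_one_fwdDiff_natCast (g : ℤ_[p] → L) (q l : ℕ) :
    Δ_[1] ^[l] (Δ_[(q : ℤ_[p])] g) 0 =
      ∑ k ∈ Finset.range q, q.choose (k + 1) • Δ_[1] ^[l + (k + 1)] g 0 := by
  have h : Δ_[(q : ℤ_[p])] g =
      ∑ k ∈ Finset.range q, q.choose (k + 1) • Δ_[(1 : ℤ_[p])] ^[k + 1] g := by
    funext y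
    have := shift_eq_sum_fwdDiff_iter (1 : ℤ_[p]) g q y
    rw [nsmul_one, Finset.sum_range_succ'] at this
    simp [fwdDiff, this]
  rw [h, fwdDiff_iter_finsetSum, Finset.sum_apply]
  refine Finset.sum_congr rfl fun k _ => ?_
  rw [fwdDiff_iter_const_smul, ← Function.iterate_add_apply, Pi.smul_apply]

/-- One application of `Δ_[pⁿ]` gains a factor `m / pⁿ` on the `m`-th Mahler coefficient. -/
lemma norm_mahler_fwdDiff_prime_pow_le [IsUltrametricDist L] {g : ℤ_[p] → L} {B : ℝ} {n t : ℕ}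
    (hg : ∀ m : ℕ, ‖Δ_[1] ^[m] g 0‖ * min 1 (((m : ℝ) / (p : ℝ) ^ n) ^ (t + 1)) ≤ B) (l : ℕ) :
    ‖Δ_[1] ^[l] (Δ_[((p ^ n : ℕ) : ℤ_[p])] g) 0‖ * min 1 (((l : ℝ) / (p : ℝ) ^ n) ^ t) ≤ B := by
  have hp := (Fact.out : p.Prime).pos
  have hB : 0 ≤ B := (by positivity : (0 : ℝ) ≤ _).trans (hg 0)
  set w : ℝ := min 1 (((l : ℝ) / (p : ℝ) ^ n) ^ t) with hw
  have hw0 : 0 ≤ w := by positivity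
  rw [fwdDiff_iter_one_fwdDiff_natCast]
  obtain ⟨k, hk, hle⟩ := IsUltrametricDist.exists_norm_finsetSum_le (Finset.range (p ^ n))
    (fun k => (p ^ n).choose (k + 1) • Δ_[1] ^[l + (k + 1)] g (0 : ℤ_[p]))
  have hkq : k + 1 ≤ p ^ n := by
    have := hk ⟨0, by simpa using pow_pos hp n⟩
    simpa using this
  refine (mul_le_mul_of_nonneg_right hle hw0).trans ?_
  refine le_trans ?_ (hg (l + (k + 1)))
  rw [nsmul_eq_mul, norm_mul, mul_comm ‖((p ^ n).choose (k + 1) : L)‖, mul_assoc]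
  refine mul_le_mul_of_nonneg_left ?_ (norm_nonneg _)
  have h1 := norm_choose_prime_pow_le (p := p) (L := L) n k
  have h2 : ((k + 1 : ℕ) : ℝ) / (p : ℝ) ^ n ≤ 1 := by
    rw [div_le_one (by positivity)]; exact_mod_cast hkq
  refine le_min (mul_le_one₀ (h1.trans h2) hw0 (min_le_left _ _)) ?_
  calc _ ≤ ((k + 1 : ℕ) : ℝ) / (p : ℝ) ^ n * ((l : ℝ) / (p : ℝ) ^ n) ^ t :=
        mul_le_mul h1 (min_le_right _ _) hw0 (by positivity)
    _ ≤ ((l + (k + 1) : ℕ) : ℝ) / (p : ℝ) ^ n * (((l + (k + 1) : ℕ) : ℝ) / (p : ℝ) ^ n) ^ t := by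
        have h3 : (l : ℝ) ≤ ((l + (k + 1) : ℕ) : ℝ) := by exact_mod_cast Nat.le_add_right _ _
        have h4 : ((k + 1 : ℕ) : ℝ) ≤ ((l + (k + 1) : ℕ) : ℝ) := by
          exact_mod_cast Nat.le_add_left _ _
        refine mul_le_mul (by gcongr) (by gcongr) (by positivity) (by positivity)
    _ = _ := by rw [pow_succ, mul_comm]

lemma norm_fwdDiff_iter_prime_pow_le [IsUltrametricDist L] {n : ℕ} {B : ℝ} (s : ℕ)
    {f : ℤ_[p] → L}
    (hf : ∀ m : ℕ, ‖Δ_[1] ^[m] f 0‖ * min 1 (((m : ℝ) / (p : ℝ) ^ n) ^ s) ≤ B) (c : ℕ) :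
    ‖Δ_[((p ^ n : ℕ) : ℤ_[p])] ^[s] f c‖ ≤ B := by
  induction s generalizing f with
  | zero => exact norm_natCast_le_of_norm_fwdDiff_iter_le (fun k => by simpa using hf k) c
  | succ s ih => exact ih (norm_mahler_fwdDiff_prime_pow_le hf)

end
section

variable {p L}

/-- The functions `ℤ_p → L` that are polynomial of degree at most `d` on each ball of radius
`p⁻ⁿ`. -/
def levelPoly (p : ℕ) [Fact p.Prime] (L : Type) [NontriviallyNormedField L]
    [NormedAlgebra ℚ_[p] L] (n d : ℕ) : Submodule L (ℤ_[p] → L) where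
  carrier := {f | ∀ a : ℤ_[p], ∃ P : Polynomial L, P.natDegree ≤ d ∧ ∀ z : ℤ_[p],
    ‖z - a‖ ≤ (p : ℝ) ^ (-(n : ℤ)) → f z = Polynomial.eval (iotaL p L (z : ℚ_[p])) P}
  add_mem' {f g} hf hg a := by
    obtain ⟨P, hP, hPf⟩ := hf a
    obtain ⟨Q, hQ, hQg⟩ := hg a
    exact ⟨P + Q, (Polynomial.natDegree_add_le _ _).trans (max_le hP hQ), fun z hz => by
      simp [hPf z hz, hQg z hz]⟩
  zero_mem' a := ⟨0, by simp, by simp⟩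
  smul_mem' c f hf a := by
    obtain ⟨P, hP, hPf⟩ := hf a
    exact ⟨c • P, (Polynomial.natDegree_smul_le _ _).trans hP, fun z hz => by
      simp [hPf z hz]⟩

lemma isLocPoly_of_mem_levelPoly {n d : ℕ} {f : ℤ_[p] → L} (hf : f ∈ levelPoly p L n d) :
    IsLocPoly p L d f := ⟨n, hf⟩

lemma levelPoly_mono {m n d : ℕ} (h : m ≤ n) : levelPoly p L m d ≤ levelPoly p L n d := by
  intro f hf a
  obtain ⟨P, hP, hPf⟩ := hf a
  have hp := (Fact.out : p.Prime).one_le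
  exact ⟨P, hP, fun z hz => hPf z (hz.trans (zpow_le_zpow_right₀ (by exact_mod_cast hp)
    (by omega)))⟩

lemma norm_sub_le_of_norm_sub_le {x y z : ℤ_[p]} {ε : ℝ} (hxy : ‖x - y‖ ≤ ε)
    (hyz : ‖y - z‖ ≤ ε) : ‖x - z‖ ≤ ε := by
  rw [← sub_add_sub_cancel x y z]
  exact (PadicInt.nonarchimedean _ _).trans (max_le hxy hyz)

lemma indPoly_mem_levelPoly (a : ℤ_[p]) (n : ℕ) {j d : ℕ} (hj : j ≤ d) :
    indPoly p L a n j ∈ levelPoly p L n d := by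
  intro b
  by_cases h : ‖b - a‖ ≤ (p : ℝ) ^ (-(n : ℤ))
  · refine ⟨(Polynomial.X - Polynomial.C (iotaL p L a)) ^ j, ?_, fun z hz => ?_⟩
    · simpa using hj
    · simp only [indPoly, if_pos (norm_sub_le_of_norm_sub_le hz h)]
      simp [iotaL]
  · refine ⟨0, by simp, fun z hz => ?_⟩
    have : ¬ ‖z - a‖ ≤ (p : ℝ) ^ (-(n : ℤ)) := fun hza =>
      h (norm_sub_le_of_norm_sub_le (by rwa [norm_sub_rev]) hza)
    simp only [indPoly, if_neg this, Polynomial.eval_zero]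

lemma continuous_of_mem_levelPoly {n d : ℕ} {f : ℤ_[p] → L} (hf : f ∈ levelPoly p L n d) :
    Continuous f := by
  have hp := (Fact.out : p.Prime).pos
  refine continuous_iff_continuousAt.2 fun a => ?_
  obtain ⟨P, -, hP⟩ := hf a
  have hι : Continuous fun z : ℤ_[p] => iotaL p L (z : ℚ_[p]) :=
    (algebraMapCLM ℚ_[p] L).continuous.comp continuous_subtype_val
  refine ContinuousAt.congr (P.continuous.comp hι).continuousAt ?_
  filter_upwards [Metric.closedBall_mem_nhds a 
    (zpow_pos (by exact_mod_cast hp : (0 : ℝ) < p) (-(n : ℤ)))]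
    with z hz
  rw [Metric.mem_closedBall, dist_eq_norm] at hz
  exact (hP z hz).symm

lemma norm_nsmul_prime_pow_le (k n : ℕ) :
    ‖k • ((p ^ n : ℕ) : ℤ_[p])‖ ≤ (p : ℝ) ^ (-(n : ℤ)) := by
  rw [nsmul_eq_mul, norm_mul, Nat.cast_pow, PadicInt.norm_p_pow]
  exact mul_le_of_le_one_left (by positivity) (PadicInt.norm_le_one _)

lemma fwdDiff_iter_eq_zero_of_mem_levelPoly {n d i : ℕ} {f : ℤ_[p] → L}
    (hf : f ∈ levelPoly p L n d) (hi : d < i) : Δ_[((p ^ n : ℕ) : ℤ_[p])] ^[i] f = 0 := by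
  funext z
  obtain ⟨P, hPd, hP⟩ := hf z
  set Q : Polynomial L := P.comp (Polynomial.C ((p : L) ^ n) * Polynomial.X +
    Polynomial.C (iotaL p L z)) with hQ
  have hQd : Q.natDegree < i := by
    refine lt_of_le_of_lt (Polynomial.natDegree_comp_le.trans ?_) hi
    calc _ ≤ d * 1 := Nat.mul_le_mul hPd Polynomial.natDegree_linear_le
      _ = d := mul_one d
  have h0 := congrFun (Polynomial.fwdDiff_iter_eq_zero_of_degree_lt hQd) 0
  rw [fwdDiff_iter_eq_sum_shift] at h0 ⊢
  rw [Pi.zero_apply] at h0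
  rw [Pi.zero_apply, ← h0]
  refine Finset.sum_congr rfl fun k _ => ?_
  rw [hP _ (by rw [add_sub_cancel_left]; exact norm_nsmul_prime_pow_le k n), hQ]
  congr 1
  simp only [Polynomial.eval_comp]
  congr 1
  simp [iotaL]
  ring

/-- The function `z ↦ 1_{c + pⁿℤ_p}(z) binom((z - c) / pⁿ, i)`. -/
def newtonBasis (p : ℕ) [Fact p.Prime] (L : Type) [NontriviallyNormedField L]
    [NormedAlgebra ℚ_[p] L] (n : ℕ) (c : ℤ_[p]) (i : ℕ) : ℤ_[p] → L :=
  ∑ j ∈ Finset.range (i + 1), ((descPochhammer L i).coeff j / (i.factorial : L) *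
    ((p : L) ^ n)⁻¹ ^ j) • indPoly p L c n j

lemma newtonBasis_apply_of_norm_le {n : ℕ} {c z : ℤ_[p]} (i : ℕ)
    (hz : ‖z - c‖ ≤ (p : ℝ) ^ (-(n : ℤ))) :
    newtonBasis p L n c i z =
      ((descPochhammer L i).comp (Polynomial.C ((p : L) ^ n)⁻¹ * Polynomial.X)).eval
        (iotaL p L ((z : ℚ_[p]) - c)) / (i.factorial : L) := by
  rw [Polynomial.eval_comp, Polynomial.eval_eq_sum_range, descPochhammer_natDegree,
    Finset.sum_div, newtonBasis, Finset.sum_apply]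
  refine Finset.sum_congr rfl fun j _ => ?_
  simp only [Pi.smul_apply, indPoly, hz, if_true, smul_eq_mul, Polynomial.eval_mul,
    Polynomial.eval_C, Polynomial.eval_X, mul_pow]
  ring

lemma newtonBasis_apply_of_not_norm_le {n : ℕ} {c z : ℤ_[p]} (i : ℕ)
    (hz : ¬ ‖z - c‖ ≤ (p : ℝ) ^ (-(n : ℤ))) : newtonBasis p L n c i z = 0 := by
  simp only [newtonBasis, indPoly, Finset.sum_apply, Pi.smul_apply, if_neg hz, smul_zero,
    Finset.sum_const_zero]

lemma newtonBasis_mem_levelPoly (n : ℕ) (c : ℤ_[p]) {i d : ℕ} (hi : i ≤ d) :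
    newtonBasis p L n c i ∈ levelPoly p L n d := by
  refine Submodule.sum_mem _ fun j hj => Submodule.smul_mem _ _ (indPoly_mem_levelPoly _ _ ?_)
  have := Finset.mem_range.1 hj
  omega

/-- The projection onto functions that are polynomial of degree at most `d` on balls of radius
`p⁻ⁿ`, interpolating at the integers `0, …, (d + 1) pⁿ - 1`. -/
def newtonProj (p : ℕ) [Fact p.Prime] (L : Type) [NontriviallyNormedField L]
    [NormedAlgebra ℚ_[p] L] (n d : ℕ) : (ℤ_[p] → L) →ₗ[L] (ℤ_[p] → L) where
  toFun f := ∑ c ∈ Finset.range (p ^ n), ∑ i ∈ Finset.range (d + 1),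
    (Δ_[((p ^ n : ℕ) : ℤ_[p])] ^[i] f c) • newtonBasis p L n c i
  map_add' f g := by simp [add_smul, Finset.sum_add_distrib]
  map_smul' a f := by simp [Finset.smul_sum, smul_smul]

lemma newtonProj_eq_sum (n d : ℕ) (f : ℤ_[p] → L) :
    newtonProj p L n d f = ∑ c ∈ Finset.range (p ^ n), ∑ i ∈ Finset.range (d + 1),
      (Δ_[((p ^ n : ℕ) : ℤ_[p])] ^[i] f c) • newtonBasis p L n c i := rfl

lemma newtonProj_mem_levelPoly (n d : ℕ) (f : ℤ_[p] → L) :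
    newtonProj p L n d f ∈ levelPoly p L n d := by
  rw [newtonProj_eq_sum]
  refine Submodule.sum_mem (levelPoly p L n d) fun c _ => Submodule.sum_mem _ fun i hi =>
    Submodule.smul_mem _ _ (newtonBasis_mem_levelPoly _ _ ?_)
  have := Finset.mem_range.1 hi
  omega

lemma newtonProj_apply {n d c : ℕ} (hc : c < p ^ n) {z : ℤ_[p]}
    (hz : ‖z - c‖ ≤ (p : ℝ) ^ (-(n : ℤ))) (f : ℤ_[p] → L) :
    newtonProj p L n d f z = ∑ i ∈ Finset.range (d + 1),
      (Δ_[((p ^ n : ℕ) : ℤ_[p])] ^[i] f c) *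
      (((descPochhammer L i).comp (Polynomial.C ((p : L) ^ n)⁻¹ * Polynomial.X)).eval
        (iotaL p L ((z : ℚ_[p]) - ((c : ℤ_[p]) : ℚ_[p]))) / (i.factorial : L)) := by
  simp only [newtonProj_eq_sum, Finset.sum_apply, Pi.smul_apply, smul_eq_mul]
  rw [Finset.sum_eq_single c]
  · exact Finset.sum_congr rfl fun i _ => by rw [newtonBasis_apply_of_norm_le i hz]
  · intro b hb hbc
    refine Finset.sum_eq_zero fun i _ => ?_
    rw [newtonBasis_apply_of_not_norm_le, mul_zero]
    intro hzb
    have h := norm_sub_le_of_norm_sub_le (by rwa [norm_sub_rev] : ‖(b : ℤ_[p]) - z‖ ≤ _) hz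
    have h' : ‖(((b : ℤ) - (c : ℤ) : ℤ) : ℤ_[p])‖ ≤ (p : ℝ) ^ (-(n : ℤ)) := by
      push_cast; exact h
    rw [PadicInt.norm_int_le_pow_iff_dvd] at h'
    have hb := Finset.mem_range.1 hb
    refine hbc ?_
    have : (c : ℤ) ≡ b [ZMOD ((p ^ n : ℕ) : ℤ)] := Int.modEq_iff_dvd.2 (by exact_mod_cast h')
    exact (Nat.ModEq.eq_of_lt_of_lt (Int.natCast_modEq_iff.1 this) hc hb).symm
  · intro h
    exact absurd (Finset.mem_range.2 hc) h

lemma newtonProj_apply_add_nsmul {n d c : ℕ} (hc : c < p ^ n) (x : ℕ) (f : ℤ_[p] → L) :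
    newtonProj p L n d f (c + x • ((p ^ n : ℕ) : ℤ_[p])) = ∑ i ∈ Finset.range (d + 1),
      x.choose i • Δ_[((p ^ n : ℕ) : ℤ_[p])] ^[i] f c := by
  have := charZero_of_normedAlgebra_padic p L
  rw [newtonProj_apply hc (by rw [add_sub_cancel_left]; exact norm_nsmul_prime_pow_le x n)]
  refine Finset.sum_congr rfl fun i _ => ?_
  rw [nsmul_eq_mul (x.choose i), mul_comm, Nat.cast_choose_eq_descPochhammer_div,
    Polynomial.eval_comp]
  congr 4
  have h0 := natCast_prime_pow_ne_zero (p := p) (L := L) n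
  simp [iotaL]
  field_simp

lemma apply_eq_newtonProj_add {n c : ℕ} (d : ℕ) (hc : c < p ^ n) (x : ℕ) (f : ℤ_[p] → L) :
    f (c + x • ((p ^ n : ℕ) : ℤ_[p])) =
      newtonProj p L n d f (c + x • ((p ^ n : ℕ) : ℤ_[p])) + ∑ k ∈ Finset.range x,
        x.choose (d + 1 + k) • Δ_[((p ^ n : ℕ) : ℤ_[p])] ^[d + 1 + k] f c := by
  rw [newtonProj_apply_add_nsmul hc, ← Finset.sum_range_add,
    shift_eq_sum_fwdDiff_iter ((p ^ n : ℕ) : ℤ_[p]) f x c]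
  refine Finset.sum_subset (Finset.range_subset_range.2 (by omega)) fun i _ hi => ?_
  rw [Nat.choose_eq_zero_of_lt (by simpa using hi), zero_smul]

lemma newtonProj_eq_self {n d : ℕ} {f : ℤ_[p] → L} (hf : f ∈ levelPoly p L n d) :
    newtonProj p L n d f = f := by
  have hchar := charZero_of_normedAlgebra_padic p L
  funext z
  have hc := z.appr_lt n
  have hz : ‖z - (z.appr n : ℤ_[p])‖ ≤ (p : ℝ) ^ (-(n : ℤ)) :=
    (PadicInt.norm_le_pow_iff_mem_span_pow _ _).2 (PadicInt.appr_spec n z)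
  set c := z.appr n
  obtain ⟨P, -, hP⟩ := hf c
  have hq := natCast_prime_pow_ne_zero (p := p) (L := L) n
  have key : P.comp (Polynomial.X + Polynomial.C (c : L)) =
      ∑ i ∈ Finset.range (d + 1), Polynomial.C (Δ_[((p ^ n : ℕ) : ℤ_[p])] ^[i] f c) *
        (((descPochhammer L i).comp (Polynomial.C ((p : L) ^ n)⁻¹ * Polynomial.X)) *
          Polynomial.C (i.factorial : L)⁻¹) := by
    refine Polynomial.eq_of_infinite_eval_eq _ _ ((Set.infinite_range_of_injective
      (f := fun x : ℕ => (x : L) * (p : L) ^ n) fun x y hxy => ?_).mono ?_)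
    · exact Nat.cast_injective (mul_right_cancel₀ hq hxy)
    · rintro _ ⟨x, rfl⟩
      have hx : ‖(c + x • ((p ^ n : ℕ) : ℤ_[p])) - (c : ℤ_[p])‖ ≤ (p : ℝ) ^ (-(n : ℤ)) := by
        rw [add_sub_cancel_left]; exact norm_nsmul_prime_pow_le x n
      have h1 := apply_eq_newtonProj_add d hc x f
      rw [Finset.sum_eq_zero (s := Finset.range x) fun k _ => by
        rw [fwdDiff_iter_eq_zero_of_mem_levelPoly hf (by omega)]; simp, add_zero, hP _ hx,
        newtonProj_apply hc hx] at h1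
      have h2 : iotaL p L (((c + x • ((p ^ n : ℕ) : ℤ_[p]) : ℤ_[p]) : ℚ_[p]) -
          ((c : ℤ_[p]) : ℚ_[p])) = (x : L) * (p : L) ^ n := by simp [iotaL]
      have h3 : iotaL p L ((c + x • ((p ^ n : ℕ) : ℤ_[p]) : ℤ_[p]) : ℚ_[p]) =
          (x : L) * (p : L) ^ n + c := by simp [iotaL]; ring
      rw [h2, h3] at h1
      simpa [Polynomial.eval_finsetSum, div_eq_mul_inv] using h1
  rw [newtonProj_apply hc hz, hP z hz]
  have h4 := congrArg (Polynomial.eval (iotaL p L ((z : ℚ_[p]) - ((c : ℤ_[p]) : ℚ_[p])))) key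
  simp only [Polynomial.eval_finsetSum, Polynomial.eval_mul, Polynomial.eval_C,
    ← div_eq_mul_inv] at h4
  rw [← h4, Polynomial.eval_comp]
  congr 1
  simp [iotaL]

lemma norm_sub_newtonProj_le [IsUltrametricDist L] {n d : ℕ} {f : ℤ_[p] → L} {B : ℝ}
    (hf : ∀ c : ℕ, ‖Δ_[((p ^ n : ℕ) : ℤ_[p])] ^[d + 1] f c‖ ≤ B) (z : ℕ) :
    ‖(f - newtonProj p L n d f) z‖ ≤ B := by
  have hq : 0 < p ^ n := pow_pos (Fact.out : p.Prime).pos n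
  have hz : (z : ℤ_[p]) = ((z % p ^ n : ℕ) : ℤ_[p]) + (z / p ^ n) • ((p ^ n : ℕ) : ℤ_[p]) := by
    rw [nsmul_eq_mul, mul_comm, ← Nat.cast_mul, ← Nat.cast_add, Nat.mod_add_div]
  rw [Pi.sub_apply, hz, apply_eq_newtonProj_add d (Nat.mod_lt z hq) _ f, add_sub_cancel_left]
  refine IsUltrametricDist.norm_sum_le_of_forall_le_of_nonneg
    ((norm_nonneg _).trans (hf 0)) fun k _ => (norm_nsmul_le_norm _ _).trans ?_
  rw [add_comm (d + 1) k, Function.iterate_add_apply]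
  refine norm_fwdDiff_iter_le_s1 _ (fun l => ?_) k
  have := hf (z % p ^ n + l * p ^ n)
  rwa [Nat.cast_add, Nat.cast_mul, ← nsmul_eq_mul] at this

end
section

variable {p L}

namespace PolDual

variable {d : ℕ} (μ : PolDual p L d)

lemma map_zero : μ.toFun 0 = 0 := by
  simpa using μ.map_smul' 0 0 (isLocPoly_of_mem_levelPoly (levelPoly p L 0 d).zero_mem)

lemma map_sub_of_mem_levelPoly {n : ℕ} {f g : ℤ_[p] → L} (hf : f ∈ levelPoly p L n d)
    (hg : g ∈ levelPoly p L n d) : μ.toFun (f - g) = μ.toFun f - μ.toFun g := by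
  rw [sub_eq_add_neg, ← neg_one_smul L g, μ.map_add' _ _ (isLocPoly_of_mem_levelPoly hf)
    (isLocPoly_of_mem_levelPoly (Submodule.smul_mem _ _ hg)),
    μ.map_smul' _ _ (isLocPoly_of_mem_levelPoly hg)]
  ring

lemma norm_map_sum_le [IsUltrametricDist L] {ι : Type*} {n : ℕ} (s : Finset ι)
    (f : ι → ℤ_[p] → L) {B : ℝ} (hB : 0 ≤ B) (hf : ∀ i ∈ s, f i ∈ levelPoly p L n d)
    (hμ : ∀ i ∈ s, ‖μ.toFun (f i)‖ ≤ B) : ‖μ.toFun (∑ i ∈ s, f i)‖ ≤ B := by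
  induction s using Finset.induction_on with
  | empty => simpa [μ.map_zero] using hB
  | insert i s hi ih =>
    simp only [Finset.forall_mem_insert] at hf hμ
    rw [Finset.sum_insert hi, μ.map_add' _ _ (isLocPoly_of_mem_levelPoly hf.1)
      (isLocPoly_of_mem_levelPoly (Submodule.sum_mem _ hf.2))]
    exact (IsUltrametricDist.norm_add_le_max _ _).trans (max_le hμ.1 (ih hf.2 hμ.2))

end PolDual

lemma norm_inv_factorial_le (p : ℕ) [Fact p.Prime] {L : Type} [NontriviallyNormedField L]
    [NormedAlgebra ℚ_[p] L] [IsUltrametricDist L] {i d : ℕ} (hi : i ≤ d) :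
    ‖(i.factorial : L)‖⁻¹ ≤ ‖(d.factorial : L)‖⁻¹ := by
  have := charZero_of_normedAlgebra_padic p L
  obtain ⟨k, hk⟩ := Nat.factorial_dvd_factorial hi
  refine inv_anti₀ (norm_pos_iff.2 (by exact_mod_cast d.factorial_ne_zero)) ?_
  rw [hk, Nat.cast_mul, norm_mul]
  exact mul_le_of_le_one_right (norm_nonneg _) (IsUltrametricDist.norm_natCast_le_one L k)

lemma norm_descPochhammer_coeff_le [IsUltrametricDist L] (i j : ℕ) :
    ‖(descPochhammer L i).coeff j‖ ≤ 1 := by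
  rw [← descPochhammer_map (Int.castRingHom L), Polynomial.coeff_map]
  exact IsUltrametricDist.norm_intCast_le_one L _

section bounds

variable [IsUltrametricDist L] {d : ℕ} {μ : PolDual p L d} {C r : ℝ}

lemma norm_map_newtonBasis_le (hC : 0 ≤ C)
    (hμ : ∀ (a : ℤ_[p]) (j : ℕ), j ≤ d → ∀ n : ℕ,
      ‖μ.toFun (indPoly p L a n j)‖ ≤ C * (p : ℝ) ^ ((n : ℝ) * (r - (j : ℝ))))
    (n : ℕ) (c : ℤ_[p]) {i : ℕ} (hi : i ≤ d) :
    ‖μ.toFun (newtonBasis p L n c i)‖ ≤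
      C * ‖(d.factorial : L)‖⁻¹ * (p : ℝ) ^ ((n : ℝ) * r) := by
  have hp : (0 : ℝ) < p := by exact_mod_cast (Fact.out : p.Prime).pos
  have hj {j : ℕ} (h : j ∈ Finset.range (i + 1)) : j ≤ d := by
    have := Finset.mem_range.1 h
    omega
  refine μ.norm_map_sum_le (n := n) _ _ (by positivity)
    (fun j h => Submodule.smul_mem _ _ (indPoly_mem_levelPoly _ _ (hj h))) fun j h => ?_
  rw [μ.map_smul' _ _ (isLocPoly_of_mem_levelPoly (indPoly_mem_levelPoly c n (hj h))), norm_mul,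
    norm_mul, norm_div, norm_pow, norm_inv, norm_natCast_prime_pow, inv_inv, div_eq_mul_inv]
  have h1 : (p : ℝ) ^ ((n : ℝ) * r) = ((p : ℝ) ^ n) ^ j * (p : ℝ) ^ ((n : ℝ) * (r - (j : ℝ))) := by
    rw [← pow_mul, ← Real.rpow_natCast, ← Real.rpow_add hp]
    congr 1
    push_cast
    ring
  calc _ ≤ 1 * ‖(d.factorial : L)‖⁻¹ * ((p : ℝ) ^ n) ^ j *
        (C * (p : ℝ) ^ ((n : ℝ) * (r - (j : ℝ)))) := by
        have h2 := norm_inv_factorial_le p (L := L) hi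
        gcongr ?_ * ?_ * _ * ?_
        · exact norm_descPochhammer_coeff_le i j
        · exact hμ c j (hj h) n
    _ = _ := by rw [h1]; ring

lemma norm_map_newtonProj_le (hC : 0 ≤ C)
    (hμ : ∀ (a : ℤ_[p]) (j : ℕ), j ≤ d → ∀ n : ℕ,
      ‖μ.toFun (indPoly p L a n j)‖ ≤ C * (p : ℝ) ^ ((n : ℝ) * (r - (j : ℝ))))
    (n : ℕ) {f : ℤ_[p] → L} {B : ℝ} (hf : ∀ c : ℕ, ‖f c‖ ≤ B) :
    ‖μ.toFun (newtonProj p L n d f)‖ ≤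
      C * ‖(d.factorial : L)‖⁻¹ * (p : ℝ) ^ ((n : ℝ) * r) * B := by
  have hB : 0 ≤ B := (norm_nonneg _).trans (hf 0)
  have hi {i : ℕ} (h : i ∈ Finset.range (d + 1)) : i ≤ d := by
    have := Finset.mem_range.1 h
    omega
  have hmem (c i : ℕ) (h : i ∈ Finset.range (d + 1)) :=
    Submodule.smul_mem _ (Δ_[((p ^ n : ℕ) : ℤ_[p])] ^[i] f c)
      (newtonBasis_mem_levelPoly (L := L) n (c : ℤ_[p]) (hi h))
  rw [newtonProj_eq_sum]
  refine μ.norm_map_sum_le (n := n) _ _ (by positivity)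
    (fun c _ => Submodule.sum_mem _ (hmem c)) fun c _ => ?_
  refine μ.norm_map_sum_le (n := n) _ _ (by positivity) (hmem c) fun i h => ?_
  rw [μ.map_smul' _ _ (isLocPoly_of_mem_levelPoly (newtonBasis_mem_levelPoly n _ (hi h))),
    norm_mul, mul_comm]
  refine mul_le_mul (norm_map_newtonBasis_le hC hμ n _ (hi h)) ?_ (norm_nonneg _) (by positivity)
  refine norm_fwdDiff_iter_le_s1 _ (fun k => ?_) i
  have := hf (c + k * p ^ n)
  rwa [Nat.cast_add, Nat.cast_mul, ← nsmul_eq_mul] at this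

lemma norm_map_newtonProj_succ_sub_le (hC : 0 ≤ C)
    (hμ : ∀ (a : ℤ_[p]) (j : ℕ), j ≤ d → ∀ n : ℕ,
      ‖μ.toFun (indPoly p L a n j)‖ ≤ C * (p : ℝ) ^ ((n : ℝ) * (r - (j : ℝ))))
    (n : ℕ) {f : ℤ_[p] → L} {B : ℝ}
    (hf : ∀ m : ℕ, ‖mahlerCoeff p L f m‖ *
      ((p : ℝ) ^ ((n : ℝ) * r) * min 1 (((m : ℝ) / (p : ℝ) ^ n) ^ (d + 1))) ≤ B) :
    ‖μ.toFun (newtonProj p L (n + 1) d f) - μ.toFun (newtonProj p L n d f)‖ ≤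
      C * ‖(d.factorial : L)‖⁻¹ * (p : ℝ) ^ r * B := by
  have hp : (0 : ℝ) < p := by exact_mod_cast (Fact.out : p.Prime).pos
  have hmem : newtonProj p L n d f ∈ levelPoly p L (n + 1) d :=
    levelPoly_mono n.le_succ (newtonProj_mem_levelPoly n d f)
  rw [← μ.map_sub_of_mem_levelPoly (newtonProj_mem_levelPoly (n + 1) d f) hmem]
  rw [← newtonProj_eq_self hmem]
  rw [← map_sub]
  have hpn : (0 : ℝ) < (p : ℝ) ^ ((n : ℝ) * r) := by positivity
  have h1 := norm_fwdDiff_iter_prime_pow_le (n := n) (d + 1) (f := f)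
    (B := B / (p : ℝ) ^ ((n : ℝ) * r)) fun m => by
      rw [le_div_iff₀ hpn, ← mahlerCoeff_eq_fwdDiff_iter]
      refine le_trans (le_of_eq ?_) (hf m)
      ring
  refine (norm_map_newtonProj_le hC hμ (n + 1) (norm_sub_newtonProj_le h1)).trans (le_of_eq ?_)
  have h2 : (p : ℝ) ^ (((n + 1 : ℕ) : ℝ) * r) = (p : ℝ) ^ ((n : ℝ) * r) * (p : ℝ) ^ r := by
    rw [← Real.rpow_add hp]
    congr 1
    push_cast
    ring
  rw [h2]
  field_simp

end bounds

lemma rpow_mul_min_le {q : ℝ} (hq : 1 ≤ q) {r : ℝ} (hr : 0 ≤ r) {d : ℕ} (hd : r - 1 < d)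
    (n m : ℕ) : q ^ ((n : ℝ) * r) * min 1 (((m : ℝ) / q ^ n) ^ (d + 1)) ≤ (m : ℝ) ^ r := by
  have hq0 : 0 < q := by linarith
  have hqn : 0 < q ^ n := by positivity
  rw [Real.rpow_mul hq0.le, Real.rpow_natCast]
  rcases Nat.eq_zero_or_pos m with rfl | hm
  · simp only [Nat.cast_zero, zero_div, ne_eq, Nat.succ_ne_zero, not_false_eq_true, zero_pow]
    rw [min_eq_right zero_le_one, mul_zero]
    positivity
  have hm' : (0 : ℝ) < m := by exact_mod_cast hm
  rcases le_total (q ^ n) m with h | h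
  · calc _ ≤ (q ^ n) ^ r * 1 := by gcongr; exact min_le_left _ _
      _ ≤ _ := by rw [mul_one]; gcongr
  · have hx : (m : ℝ) / q ^ n ≤ 1 := (div_le_one hqn).2 h
    calc _ ≤ (q ^ n) ^ r * ((m : ℝ) / q ^ n) ^ (d + 1) := by gcongr; exact min_le_right _ _
      _ ≤ (q ^ n) ^ r * ((m : ℝ) / q ^ n) ^ r := by
        gcongr
        rw [← Real.rpow_natCast]
        exact Real.rpow_le_rpow_of_exponent_ge (by positivity) hx (by push_cast; linarith)
      _ = _ := by rw [← Real.mul_rpow hqn.le (by positivity), mul_div_cancel₀ _ hqn.ne']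

lemma rpow_mul_min_le_pow {q : ℝ} (hq : 1 ≤ q) (r : ℝ) (d n m : ℕ) :
    q ^ ((n : ℝ) * r) * min 1 (((m : ℝ) / q ^ n) ^ (d + 1)) ≤
      (m : ℝ) ^ (d + 1) * (q ^ (r - ((d : ℝ) + 1))) ^ n := by
  have hq0 : 0 < q := by linarith
  calc _ ≤ q ^ ((n : ℝ) * r) * ((m : ℝ) / q ^ n) ^ (d + 1) := by gcongr; exact min_le_right _ _
    _ = _ := by
      have h : (q ^ (r - ((d : ℝ) + 1))) ^ n = q ^ ((n : ℝ) * r) / (q ^ n) ^ (d + 1) := by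
        rw [← pow_mul, ← Real.rpow_natCast, ← Real.rpow_natCast, ← Real.rpow_mul hq0.le,
          ← Real.rpow_sub hq0]
        congr 1
        push_cast
        ring
      rw [h, div_pow]
      ring

namespace IsCr

variable {r : ℝ} {f : ℤ_[p] → L}

lemma bddAbove (hr : 0 ≤ r) (hf : IsCr p L r f) :
    BddAbove (Set.range fun n : ℕ => ((n : ℝ) + 1) ^ r * ‖mahlerCoeff p L f n‖) := by
  obtain ⟨K, hK⟩ := hf.1.bddAbove_range
  refine ⟨max (‖mahlerCoeff p L f 0‖) (2 ^ r * K), ?_⟩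
  rintro _ ⟨n, rfl⟩
  rcases Nat.eq_zero_or_pos n with rfl | hn
  · simp
  · refine le_max_of_le_right ?_
    have hn' : (1 : ℝ) ≤ n := by exact_mod_cast hn
    calc ((n : ℝ) + 1) ^ r * ‖mahlerCoeff p L f n‖
        ≤ (2 * (n : ℝ)) ^ r * ‖mahlerCoeff p L f n‖ := by gcongr; linarith
      _ = 2 ^ r * ((n : ℝ) ^ r * ‖mahlerCoeff p L f n‖) := by
        rw [Real.mul_rpow (by norm_num) (by positivity), mul_assoc]
      _ ≤ _ := by gcongr; exact hK ⟨n, rfl⟩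

lemma rpow_mul_norm_le_crNorm (hr : 0 ≤ r) (hf : IsCr p L r f) (n : ℕ) :
    ((n : ℝ) + 1) ^ r * ‖mahlerCoeff p L f n‖ ≤ crNorm p L r f :=
  le_ciSup (hf.bddAbove hr) n

lemma norm_mahlerCoeff_le_crNorm (hr : 0 ≤ r) (hf : IsCr p L r f) (n : ℕ) :
    ‖mahlerCoeff p L f n‖ ≤ crNorm p L r f :=
  (le_mul_of_one_le_left (norm_nonneg _) (Real.one_le_rpow (by linarith [n.cast_nonneg (α := ℝ)])
    hr)).trans (hf.rpow_mul_norm_le_crNorm hr n)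

lemma norm_mahlerCoeff_mul_le_crNorm (hr : 0 ≤ r) {d : ℕ} (hd : r - 1 < d)
    (hf : IsCr p L r f) (n m : ℕ) :
    ‖mahlerCoeff p L f m‖ *
      ((p : ℝ) ^ ((n : ℝ) * r) * min 1 (((m : ℝ) / (p : ℝ) ^ n) ^ (d + 1))) ≤
      crNorm p L r f := by
  have hp : (1 : ℝ) ≤ p := by exact_mod_cast (Fact.out : p.Prime).one_le
  refine le_trans ?_ (hf.rpow_mul_norm_le_crNorm hr m)
  rw [mul_comm]
  gcongr
  refine (rpow_mul_min_le hp hr hd n m).trans ?_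
  gcongr
  linarith

lemma eventually_norm_mahlerCoeff_mul_le (hr : 0 ≤ r) {d : ℕ} (hd : r - 1 < d)
    (hf : IsCr p L r f) {ε : ℝ} (hε : 0 < ε) :
    ∀ᶠ n : ℕ in atTop, ∀ m : ℕ, ‖mahlerCoeff p L f m‖ *
      ((p : ℝ) ^ ((n : ℝ) * r) * min 1 (((m : ℝ) / (p : ℝ) ^ n) ^ (d + 1))) ≤ ε := by
  have hp : (1 : ℝ) < p := by exact_mod_cast (Fact.out : p.Prime).one_lt
  obtain ⟨M, hM⟩ := eventually_atTop.1 (hf.1.eventually_le_const hε)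
  have hlim : Tendsto (fun n : ℕ => crNorm p L r f *
      ((M : ℝ) ^ (d + 1) * ((p : ℝ) ^ (r - ((d : ℝ) + 1))) ^ n)) atTop (nhds 0) := by
    have := tendsto_pow_atTop_nhds_zero_of_lt_one (r := (p : ℝ) ^ (r - ((d : ℝ) + 1)))
      (by positivity) (Real.rpow_lt_one_of_one_lt_of_neg hp (by linarith))
    simpa using (this.const_mul ((M : ℝ) ^ (d + 1))).const_mul (crNorm p L r f)
  filter_upwards [hlim.eventually_le_const hε] with n hn m
  rcases le_total M m with hm | hm
  · refine le_trans ?_ (hM m hm)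
    rw [mul_comm]
    gcongr
    exact rpow_mul_min_le hp.le hr hd n m
  · refine le_trans ?_ hn
    have := hf.norm_mahlerCoeff_le_crNorm hr m
    refine mul_le_mul this ?_ (by positivity) ((norm_nonneg _).trans this)
    refine (rpow_mul_min_le_pow hp.le r d n m).trans ?_
    gcongr

end IsCr

section extend

variable [IsUltrametricDist L] {d : ℕ} {μ : PolDual p L d} {C r : ℝ} {f : ℤ_[p] → L}

lemma norm_map_newtonProj_le_crNorm (hr : 0 ≤ r) (hd : r - 1 < d) (hC : 0 ≤ C)
    (hμ : ∀ (a : ℤ_[p]) (j : ℕ), j ≤ d → ∀ n : ℕ,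
      ‖μ.toFun (indPoly p L a n j)‖ ≤ C * (p : ℝ) ^ ((n : ℝ) * (r - (j : ℝ))))
    (hf : IsCr p L r f) (n : ℕ) :
    ‖μ.toFun (newtonProj p L n d f)‖ ≤
      C * ‖(d.factorial : L)‖⁻¹ * (p : ℝ) ^ r * crNorm p L r f := by
  have hp : (1 : ℝ) ≤ p := by exact_mod_cast (Fact.out : p.Prime).one_le
  have hf0 : 0 ≤ crNorm p L r f := (norm_nonneg _).trans (hf.norm_mahlerCoeff_le_crNorm hr 0)
  induction n with
  | zero =>
    have h := norm_map_newtonProj_le hC hμ 0 (f := f)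
      (norm_natCast_le_of_norm_fwdDiff_iter_le fun k => by
        rw [← mahlerCoeff_eq_fwdDiff_iter]
        exact hf.norm_mahlerCoeff_le_crNorm hr k)
    refine h.trans ?_
    gcongr
    simpa using hr
  | succ n ih =>
    have h := norm_map_newtonProj_succ_sub_le hC hμ n
      (hf.norm_mahlerCoeff_mul_le_crNorm hr hd n)
    rw [← sub_add_cancel (μ.toFun (newtonProj p L (n + 1) d f)) (μ.toFun (newtonProj p L n d f))]
    exact (IsUltrametricDist.norm_add_le_max _ _).trans (max_le h ih)

lemma exists_tendsto_map_newtonProj [CompleteSpace L] (hr : 0 ≤ r) (hd : r - 1 < d) (hC : 0 ≤ C)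
    (hμ : ∀ (a : ℤ_[p]) (j : ℕ), j ≤ d → ∀ n : ℕ,
      ‖μ.toFun (indPoly p L a n j)‖ ≤ C * (p : ℝ) ^ ((n : ℝ) * (r - (j : ℝ))))
    (hf : IsCr p L r f) :
    ∃ l : L, Tendsto (fun n => μ.toFun (newtonProj p L n d f)) atTop (nhds l) := by
  refine cauchySeq_tendsto_of_complete
    (NonarchimedeanAddGroup.cauchySeq_of_tendsto_sub_nhds_zero ?_)
  have hp : (1 : ℝ) ≤ p := by exact_mod_cast (Fact.out : p.Prime).one_le
  set K := C * ‖(d.factorial : L)‖⁻¹ * (p : ℝ) ^ r with hK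
  have hK0 : 0 ≤ K := by positivity
  refine NormedAddGroup.tendsto_nhds_zero.2 fun ε hε => ?_
  have hδ : 0 < ε / (K + 1) := by positivity
  filter_upwards [hf.eventually_norm_mahlerCoeff_mul_le hr hd hδ] with n hn
  refine (norm_map_newtonProj_succ_sub_le hC hμ n hn).trans_lt ?_
  rw [← hK, mul_div_assoc', div_lt_iff₀ (by positivity)]
  nlinarith

/-- The extension of a functional on locally polynomial functions to `C^r`, as the limit of its
values on Newton interpolations. -/
def extendCr [CompleteSpace L] (hr : 0 ≤ r) (hd : r - 1 < d) (hC : 0 ≤ C)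
    (hμ : ∀ (a : ℤ_[p]) (j : ℕ), j ≤ d → ∀ n : ℕ,
      ‖μ.toFun (indPoly p L a n j)‖ ≤ C * (p : ℝ) ^ ((n : ℝ) * (r - (j : ℝ)))) :
    CrDual p L r where
  toFun f := limUnder atTop fun n => μ.toFun (newtonProj p L n d f)
  map_add' f g hf hg := by
    refine Tendsto.limUnder_eq ?_
    refine ((tendsto_nhds_limUnder (exists_tendsto_map_newtonProj hr hd hC hμ hf)).add
      (tendsto_nhds_limUnder (exists_tendsto_map_newtonProj hr hd hC hμ hg))).congr fun n => ?_
    rw [map_add, μ.map_add' _ _ (isLocPoly_of_mem_levelPoly (newtonProj_mem_levelPoly n d f))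
      (isLocPoly_of_mem_levelPoly (newtonProj_mem_levelPoly n d g))]
  map_smul' c f hf := by
    refine Tendsto.limUnder_eq ?_
    refine ((tendsto_nhds_limUnder
      (exists_tendsto_map_newtonProj hr hd hC hμ hf)).const_mul c).congr fun n => ?_
    rw [map_smul, μ.map_smul' _ _ (isLocPoly_of_mem_levelPoly (newtonProj_mem_levelPoly n d f))]
  bound' := ⟨C * ‖(d.factorial : L)‖⁻¹ * (p : ℝ) ^ r, fun f hf =>
    le_of_tendsto (tendsto_nhds_limUnder (exists_tendsto_map_newtonProj hr hd hC hμ hf)).norm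
      (.of_forall fun n => norm_map_newtonProj_le_crNorm hr hd hC hμ hf n)⟩

lemma extendCr_apply_of_isLocPoly [CompleteSpace L] (hr : 0 ≤ r) (hd : r - 1 < d) (hC : 0 ≤ C)
    (hμ : ∀ (a : ℤ_[p]) (j : ℕ), j ≤ d → ∀ n : ℕ,
      ‖μ.toFun (indPoly p L a n j)‖ ≤ C * (p : ℝ) ^ ((n : ℝ) * (r - (j : ℝ))))
    (hf : IsLocPoly p L d f) : (extendCr hr hd hC hμ).toFun f = μ.toFun f := by
  obtain ⟨n, hn⟩ := hf
  refine Tendsto.limUnder_eq (tendsto_const_nhds.congr' ?_)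
  filter_upwards [eventually_ge_atTop n] with m hm
  rw [newtonProj_eq_self (levelPoly_mono hm hn)]

end extend

end
section

variable {p L}

/-- Decay of the Mahler coefficients of a bounded function killed by a power of `Δ_[pⁿ]`. -/
lemma norm_fwdDiff_iter_add_mul_prime_pow_le [IsUltrametricDist L] {n : ℕ} {B : ℝ} (k j l : ℕ)
    {g : ℤ_[p] → L} (hg : ∀ z, ‖g z‖ ≤ B) (hj : Δ_[((p ^ n : ℕ) : ℤ_[p])] ^[j] g = 0) :
    ‖Δ_[1] ^[l + k * p ^ n] g 0‖ * (p : ℝ) ^ k ≤ B * (p : ℝ) ^ j := by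
  have hp := (Fact.out : p.Prime)
  have hp1 : (1 : ℝ) ≤ p := by exact_mod_cast hp.one_le
  have hp0 : (0 : ℝ) < p := by linarith
  have hB : 0 ≤ B := (norm_nonneg _).trans (hg 0)
  induction k generalizing j l g with
  | zero =>
    rw [pow_zero, mul_one]
    exact (norm_fwdDiff_iter_le_s1 _ (fun _ => hg _) _).trans
      (le_mul_of_one_le_right hB (one_le_pow₀ hp1))
  | succ k ih =>
    cases j with
    | zero =>
      have h0 : Δ_[(1 : ℤ_[p])] ^[l + (k + 1) * p ^ n] g 0 = 0 := by
        rw [show g = 0 from hj, fwdDiff_iter_eq_sum_shift]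
        simp
      rw [h0, norm_zero, zero_mul]
      positivity
    | succ j =>
      obtain ⟨q, hq⟩ : ∃ q, p ^ n = q + 1 := ⟨p ^ n - 1, by have := pow_pos hp.pos n; omega⟩
      have h1 : Δ_[(1 : ℤ_[p])] ^[l + (k + 1) * p ^ n] g 0 =
          Δ_[1] ^[l + k * p ^ n] (Δ_[((p ^ n : ℕ) : ℤ_[p])] g) 0 -
          ∑ i ∈ Finset.range q, (p ^ n).choose (i + 1) •
            Δ_[(1 : ℤ_[p])] ^[(l + (i + 1)) + k * p ^ n] g 0 := by
        rw [fwdDiff_iter_one_fwdDiff_natCast, eq_sub_iff_add_eq']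
        nth_rw 4 [hq]
        rw [Finset.sum_range_succ, ← hq, Nat.choose_self, one_smul]
        congr 1
        · exact Finset.sum_congr rfl fun i _ => by rw [add_right_comm]
        · rw [add_mul, one_mul, add_assoc]
      have h2 : ‖Δ_[1] ^[l + k * p ^ n] (Δ_[((p ^ n : ℕ) : ℤ_[p])] g) 0‖ ≤
          B * (p : ℝ) ^ (j + 1) / (p : ℝ) ^ (k + 1) := by
        have := ih j l (g := Δ_[((p ^ n : ℕ) : ℤ_[p])] g)
          (fun z => by simpa using norm_fwdDiff_iter_le_s1 z (fun _ => hg _) 1) hj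
        rw [le_div_iff₀ (by positivity), pow_succ, pow_succ, ← mul_assoc, ← mul_assoc]
        gcongr
      have h3 (i : ℕ) (hi : i ∈ Finset.range q) : ‖(p ^ n).choose (i + 1) •
          Δ_[(1 : ℤ_[p])] ^[(l + (i + 1)) + k * p ^ n] g 0‖ ≤
          B * (p : ℝ) ^ (j + 1) / (p : ℝ) ^ (k + 1) := by
        have hi := Finset.mem_range.1 hi
        obtain ⟨t, ht⟩ : p ∣ (p ^ n).choose (i + 1) :=
          hp.dvd_choose_pow (by omega) (by omega)
        have hn : ‖((p ^ n).choose (i + 1) : L)‖ ≤ (p : ℝ)⁻¹ := by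
          rw [ht, Nat.cast_mul, norm_mul]
          have := norm_natCast_prime_pow (p := p) (L := L) 1
          rw [pow_one, pow_one] at this
          rw [this]
          exact mul_le_of_le_one_right (by positivity)
            (IsUltrametricDist.norm_natCast_le_one L t)
        have := ih (j + 1) (l + (i + 1)) hg hj
        rw [nsmul_eq_mul, norm_mul, le_div_iff₀ (by positivity)]
        calc _ ≤ (p : ℝ)⁻¹ * ‖Δ_[(1 : ℤ_[p])] ^[(l + (i + 1)) + k * p ^ n] g 0‖ *
              (p : ℝ) ^ (k + 1) := by gcongr
          _ = ‖Δ_[(1 : ℤ_[p])] ^[(l + (i + 1)) + k * p ^ n] g 0‖ * (p : ℝ) ^ k := by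
              rw [pow_succ]
              field_simp
          _ ≤ _ := this
      rw [← le_div_iff₀ (by positivity), h1, sub_eq_add_neg]
      refine (IsUltrametricDist.norm_add_le_max _ _).trans (max_le h2 ?_)
      rw [norm_neg]
      exact IsUltrametricDist.norm_sum_le_of_forall_le_of_nonneg (by positivity) h3

lemma norm_indPoly_le (a z : ℤ_[p]) (n j : ℕ) :
    ‖indPoly p L a n j z‖ ≤ (((p : ℝ) ^ n) ^ j)⁻¹ := by
  unfold indPoly
  split_ifs with h
  · rw [norm_pow, norm_iotaL, ← inv_pow, ← PadicInt.coe_sub]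
    rw [zpow_neg, zpow_natCast] at h
    gcongr
    exact h
  · rw [norm_zero]
    positivity

lemma norm_mahlerCoeff_indPoly_le [IsUltrametricDist L] (a : ℤ_[p]) (n j m : ℕ) :
    ‖mahlerCoeff p L (indPoly p L a n j) m‖ ≤
      (((p : ℝ) ^ n) ^ j)⁻¹ * (p : ℝ) ^ (j + 1) / (p : ℝ) ^ (m / p ^ n) := by
  have hp : (0 : ℝ) < p := by exact_mod_cast (Fact.out : p.Prime).pos
  have := norm_fwdDiff_iter_add_mul_prime_pow_le (m / p ^ n) (j + 1) (m % p ^ n)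
    (fun z => norm_indPoly_le a z n j)
    (fwdDiff_iter_eq_zero_of_mem_levelPoly (indPoly_mem_levelPoly (L := L) a n le_rfl)
      j.lt_succ_self)
  rwa [mul_comm _ (p ^ n), Nat.mod_add_div, ← le_div_iff₀ (by positivity),
    ← mahlerCoeff_eq_fwdDiff_iter] at this

lemma tendsto_add_one_rpow_div_pow {q : ℝ} (hq : 1 < q) (r : ℝ) :
    Tendsto (fun k : ℕ => ((k : ℝ) + 1) ^ r / q ^ k) atTop (nhds 0) := by
  have hq0 : 0 < q := by linarith
  have h := ((tendsto_pow_const_div_const_pow_of_one_lt ⌈r⌉₊ hq).comp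
    (tendsto_add_atTop_nat 1)).mul_const q
  rw [zero_mul] at h
  refine squeeze_zero (fun k => by positivity) (fun k => ?_) h
  simp only [Function.comp_apply, Nat.cast_add, Nat.cast_one]
  rw [pow_succ q, ← div_div, div_mul_cancel₀ _ hq0.ne']
  gcongr
  rw [← Real.rpow_natCast]
  exact Real.rpow_le_rpow_of_exponent_le (by linarith [k.cast_nonneg (α := ℝ)]) (Nat.le_ceil r)

lemma add_one_rpow_mul_norm_mahlerCoeff_indPoly_le [IsUltrametricDist L] {r : ℝ} (hr : 0 ≤ r)
    (a : ℤ_[p]) (n j m : ℕ) :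
    ((m : ℝ) + 1) ^ r * ‖mahlerCoeff p L (indPoly p L a n j) m‖ ≤
      (p : ℝ) ^ ((n : ℝ) * (r - j)) * (p : ℝ) ^ (j + 1) *
        ((((m / p ^ n : ℕ) : ℝ) + 1) ^ r / (p : ℝ) ^ (m / p ^ n)) := by
  have hp : (0 : ℝ) < p := by exact_mod_cast (Fact.out : p.Prime).pos
  have hm : (m : ℝ) + 1 ≤ (p : ℝ) ^ n * (((m / p ^ n : ℕ) : ℝ) + 1) := by
    exact_mod_cast Nat.lt_mul_div_succ m (pow_pos (Fact.out : p.Prime).pos n)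
  have hpow : (p : ℝ) ^ ((n : ℝ) * (r - j)) = ((p : ℝ) ^ n) ^ r * (((p : ℝ) ^ n) ^ j)⁻¹ := by
    rw [Real.rpow_mul hp.le, Real.rpow_natCast, Real.rpow_sub (by positivity), Real.rpow_natCast,
      div_eq_mul_inv]
  calc _ ≤ ((p : ℝ) ^ n * (((m / p ^ n : ℕ) : ℝ) + 1)) ^ r *
        ((((p : ℝ) ^ n) ^ j)⁻¹ * (p : ℝ) ^ (j + 1) / (p : ℝ) ^ (m / p ^ n)) := by
        gcongr
        exact norm_mahlerCoeff_indPoly_le a n j m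
    _ = _ := by
        rw [Real.mul_rpow (by positivity) (by positivity), hpow]
        ring

lemma coe_choose_eq_binomQ (z : ℤ_[p]) (n : ℕ) :
    ((Ring.choose z n : ℤ_[p]) : ℚ_[p]) = binomQ p z n := by
  have h := congrArg (PadicInt.Coe.ringHom (p := p))
    (Ring.descPochhammer_eq_factorial_smul_choose z n)
  rw [← Polynomial.aeval_eq_smeval, ← Polynomial.eval_map_algebraMap, descPochhammer_map,
    descPochhammer_eval_eq_prod_range, nsmul_eq_mul] at h
  simp only [map_prod, map_sub, map_natCast, map_mul] at h
  refine Eq.symm ((div_eq_iff (by exact_mod_cast n.factorial_ne_zero)).2 ?_)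
  rw [mul_comm]
  exact h

lemma hasSum_mahlerCoeff_mul_binomQ [IsUltrametricDist L] [CompleteSpace L] {f : ℤ_[p] → L}
    (hf : Continuous f) (z : ℤ_[p]) :
    HasSum (fun n : ℕ => mahlerCoeff p L f n * iotaL p L (binomQ p z n)) (f z) := by
  let _ : Module ℤ_[p] L := Module.compHom L ((algebraMap ℚ_[p] L).comp PadicInt.Coe.ringHom)
  have hsmul (x : ℤ_[p]) (y : L) : x • y = algebraMap ℚ_[p] L x * y := rfl
  have _ : IsBoundedSMul ℤ_[p] L := IsBoundedSMul.of_norm_smul_le fun x y => by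
    rw [hsmul, norm_mul, norm_algebraMap']
    rfl
  have h := (PadicInt.hasSum_mahler (⟨f, hf⟩ : C(ℤ_[p], L))).mapL (ContinuousMap.evalCLM ℤ_[p] z)
  refine h.congr_fun fun n => ?_
  rw [ContinuousMap.evalCLM_apply, PadicInt.mahlerTerm_apply, mahler_apply, hsmul,
    coe_choose_eq_binomQ, mahlerCoeff_eq_fwdDiff_iter, mul_comm]
  rfl

lemma isCr_indPoly [IsUltrametricDist L] [CompleteSpace L] {r : ℝ} (hr : 0 ≤ r)
    (a : ℤ_[p]) (n j : ℕ) : IsCr p L r (indPoly p L a n j) := by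
  have hp : (1 : ℝ) < p := by exact_mod_cast (Fact.out : p.Prime).one_lt
  refine ⟨?_, hasSum_mahlerCoeff_mul_binomQ (L := L)
    (continuous_of_mem_levelPoly (indPoly_mem_levelPoly (L := L) a n le_rfl))⟩
  have h := ((tendsto_add_one_rpow_div_pow hp r).comp
    (Nat.tendsto_div_const_atTop (pow_pos (Fact.out : p.Prime).pos n).ne')).const_mul
      ((p : ℝ) ^ ((n : ℝ) * (r - j)) * (p : ℝ) ^ (j + 1))
  rw [mul_zero] at h
  refine squeeze_zero (fun m => by positivity) (fun m => ?_) h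
  refine le_trans ?_ (add_one_rpow_mul_norm_mahlerCoeff_indPoly_le (L := L) hr a n j m)
  gcongr
  linarith

lemma exists_crNorm_indPoly_le [IsUltrametricDist L] {r : ℝ} (hr : 0 ≤ r) (d : ℕ) :
    ∃ K : ℝ, ∀ (a : ℤ_[p]) (j : ℕ), j ≤ d → ∀ n : ℕ,
      crNorm p L r (indPoly p L a n j) ≤ K * (p : ℝ) ^ ((n : ℝ) * (r - j)) := by
  have hp : (1 : ℝ) < p := by exact_mod_cast (Fact.out : p.Prime).one_lt
  obtain ⟨K, hK⟩ := (tendsto_add_one_rpow_div_pow hp r).bddAbove_range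
  refine ⟨(p : ℝ) ^ (d + 1) * K, fun a j hj n => ciSup_le fun m => ?_⟩
  refine (add_one_rpow_mul_norm_mahlerCoeff_indPoly_le hr a n j m).trans ?_
  calc _ ≤ (p : ℝ) ^ ((n : ℝ) * (r - j)) * (p : ℝ) ^ (d + 1) * K := by
        gcongr
        · exact hp.le
        · exact hK ⟨m / p ^ n, rfl⟩
    _ = _ := by ring

end

/-- **Amice–Vélu, Vishik.** A linear functional `μ` on `Pol^d(ℤ_p, L)`
(`r - 1 < d`) extends to a continuous linear functional on `C^r(ℤ_p, L)` if and
only if there is a constant `C` such that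
`|∫_{a+pⁿℤ_p} (z-a)^j dμ| ≤ C p^{n(r-j)}` for all `a ∈ ℤ_p`, `0 ≤ j ≤ d`, `n ∈ ℕ`. -/
theorem statement1 (p : ℕ) [Fact p.Prime] (L : Type) [NontriviallyNormedField L]
    [NormedAlgebra ℚ_[p] L] [FiniteDimensional ℚ_[p] L] [IsUltrametricDist L]
    (r : ℝ) (hr : 0 ≤ r) (d : ℕ) (hd : r - 1 < (d : ℝ))
    (μ : PolDual p L d) :
    (∃ ν : CrDual p L r, ∀ f : ℤ_[p] → L, IsLocPoly p L d f → ν.toFun f = μ.toFun f) ↔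
    (∃ C : ℝ, ∀ (a : ℤ_[p]) (j : ℕ), j ≤ d → ∀ n : ℕ,
      ‖μ.toFun (indPoly p L a n j)‖ ≤ C * (p : ℝ) ^ ((n : ℝ) * (r - (j : ℝ)))) := by
  have : CompleteSpace L := FiniteDimensional.complete ℚ_[p] L
  constructor
  · rintro ⟨ν, hν⟩
    obtain ⟨D, hD⟩ := ν.bound'
    obtain ⟨K, hK⟩ := exists_crNorm_indPoly_le (p := p) (L := L) hr d
    refine ⟨|D| * K, fun a j hj n => ?_⟩
    have h0 : 0 ≤ crNorm p L r (indPoly p L a n j) := Real.iSup_nonneg fun m => by positivity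
    rw [← hν _ (isLocPoly_of_mem_levelPoly (indPoly_mem_levelPoly a n hj)), mul_assoc]
    calc _ ≤ D * crNorm p L r (indPoly p L a n j) := hD _ (isCr_indPoly hr a n j)
      _ ≤ |D| * crNorm p L r (indPoly p L a n j) := by gcongr; exact le_abs_self D
      _ ≤ _ := by gcongr; exact hK a j hj n
  · rintro ⟨C, hC⟩
    have hC0 : 0 ≤ C := by simpa using (norm_nonneg _).trans (hC 0 0 d.zero_le 0)
    exact ⟨extendCr hr hd hC0 hC, fun f hf => extendCr_apply_of_isLocPoly hr hd hC0 hC hf⟩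

end Paper

end
end

section
/- Let w = Σ_{n≥0} a_n X^n ∈ R_L^+ and r ∈ ℝ≥0. (i) For every ρ ∈ (0,1), the sequence (p^{−nr} ‖w‖_{D(0,ρ^{1/p^n})})_{n≥0} is bounded if and only if the sequence ((n+1)^{−r} |a_n|)_{n≥0} is bounded; in particular, boundedness for one ρ ∈ (0,1) implies boundedness for every ρ ∈ (0,1). (ii) For each ρ ∈ (0,1) there exist constants c₁, c₂ > 0 such that for every w ∈ R_L^+ of order r, c₁ · sup_{n≥0} (n+1)^{−r}|a_n| ≤ sup_{n≥0} p^{−nr} ‖w‖_{D(0,ρ^{1/p^n})} ≤ c₂ · sup_{n≥0} (n+1)^{−r}|a_n|. -/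
open Filter Topology Classical

noncomputable section

namespace Paper

variable (p : ℕ) [Fact p.Prime]
variable (L : Type) [NontriviallyNormedField L] [NormedAlgebra ℚ_[p] L]

/-- `a : ℕ → L` is the coefficient sequence of an element `w = ∑ aₙ Xⁿ` of
`R_L^+`, i.e. the series converges on the open unit disc. -/
def MemRL (a : ℕ → L) : Prop :=
  ∀ ρ : ℝ, 0 ≤ ρ → ρ < 1 → Tendsto (fun n : ℕ => ‖a n‖ * ρ ^ n) atTop (nhds 0)

/-- The norm `‖w‖_{D(0,ρ)} = sup_n ‖aₙ‖ ρⁿ`. -/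
noncomputable def diskNorm (a : ℕ → L) (ρ : ℝ) : ℝ := ⨆ n : ℕ, ‖a n‖ * ρ ^ n

/-- The sequence `(p^{-nr} ‖w‖_{D(0,ρ^{1/pⁿ})})ₙ` is bounded. -/
def OrdBddAt (r : ℝ) (a : ℕ → L) (ρ : ℝ) : Prop :=
  ∃ C : ℝ, ∀ n : ℕ, (p : ℝ) ^ (-(n : ℝ) * r) * diskNorm L a (ρ ^ (((p : ℝ) ^ n)⁻¹)) ≤ C

/-- `w` is of order `r`. -/
def IsOrder (r : ℝ) (a : ℕ → L) : Prop :=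
  ∃ ρ : ℝ, 0 < ρ ∧ ρ < 1 ∧ OrdBddAt p L r a ρ

/-- On `[0, ∞)` the function `t ↦ (1 + t) ^ r * ρ ^ t` is bounded when `0 < ρ < 1`. -/
theorem exists_one_add_rpow_mul_rpow_le {r ρ : ℝ} (hr : 0 ≤ r) (hρ : 0 < ρ) (hρ1 : ρ < 1) :
    ∃ c : ℝ, 0 < c ∧ ∀ t : ℝ, 0 ≤ t → (1 + t) ^ r * ρ ^ t ≤ c := by
  have hlog : 0 < -Real.log ρ := neg_pos.2 (Real.log_neg hρ hρ1)
  set δ : ℝ := -Real.log ρ / (r + 1) with hδ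
  have hδ0 : 0 < δ := by positivity
  have hrδ : r * δ ≤ -Real.log ρ := by
    rw [hδ, mul_div_assoc', div_le_iff₀ (by positivity)]
    nlinarith
  refine ⟨Real.exp (r * (δ - 1 - Real.log δ)), Real.exp_pos _, fun t ht => ?_⟩
  have ht1 : 0 < 1 + t := by positivity
  rw [Real.rpow_def_of_pos ht1, Real.rpow_def_of_pos hρ, ← Real.exp_add]
  apply Real.exp_le_exp.2
  have hbound : Real.log (1 + t) ≤ (1 + t) * δ - 1 - Real.log δ := by
    have := Real.log_le_sub_one_of_pos (mul_pos ht1 hδ0)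
    rw [Real.log_mul ht1.ne' hδ0.ne'] at this
    linarith
  nlinarith [mul_le_mul_of_nonneg_left hbound hr, mul_le_mul_of_nonneg_right hrδ ht]

section Bounds

variable {p : ℕ} [Fact p.Prime]
variable {L : Type} [NontriviallyNormedField L]
variable {r ρ C : ℝ} {a : ℕ → L}

/-- A bound on the weighted coefficients bounds the weighted disk norms, with a constant
independent of the series. -/
theorem exists_weighted_diskNorm_le (p : ℕ) [Fact p.Prime] (L : Type) [NontriviallyNormedField L]
    (hr : 0 ≤ r) (hρ : 0 < ρ) (hρ1 : ρ < 1) :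
    ∃ c : ℝ, 0 < c ∧ ∀ (a : ℕ → L) (C : ℝ), (∀ m : ℕ, ((m : ℝ) + 1) ^ (-r) * ‖a m‖ ≤ C) →
      ∀ n : ℕ, (p : ℝ) ^ (-(n : ℝ) * r) * diskNorm L a (ρ ^ (((p : ℝ) ^ n)⁻¹)) ≤ c * C := by
  obtain ⟨c, hc, hbound⟩ := exists_one_add_rpow_mul_rpow_le hr hρ hρ1
  refine ⟨c, hc, fun a C hC n => ?_⟩
  have hp1 : (1 : ℝ) ≤ p := by exact_mod_cast (Fact.out : p.Prime).one_lt.le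
  have hp0 : (0 : ℝ) < p := by positivity
  have hq1 : (1 : ℝ) ≤ (p : ℝ) ^ n := one_le_pow₀ hp1
  have hpow : (p : ℝ) ^ (-(n : ℝ) * r) = ((p : ℝ) ^ n) ^ (-r) := by
    rw [← Real.rpow_natCast, ← Real.rpow_mul hp0.le]
    ring_nf
  rw [hpow]
  set q : ℝ := (p : ℝ) ^ n
  have hq0 : 0 < q := by positivity
  rw [diskNorm, Real.mul_iSup_of_nonneg (by positivity)]
  refine ciSup_le fun m => ?_
  have hm : (0 : ℝ) < (m : ℝ) + 1 := by positivity
  have hC0 : 0 ≤ C := le_trans (by positivity) (hC m)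
  have hρm : (ρ ^ q⁻¹) ^ m = ρ ^ ((m : ℝ) / q) := by
    rw [← Real.rpow_natCast, ← Real.rpow_mul hρ.le]
    ring_nf
  have hbase : ((m : ℝ) + 1) / q ≤ 1 + (m : ℝ) / q := by
    rw [add_div, add_comm]
    gcongr
    exact div_le_one_of_le₀ hq1 hq0.le
  have hratio : q ^ (-r) * ((m : ℝ) + 1) ^ r ≤ (1 + (m : ℝ) / q) ^ r := by
    calc q ^ (-r) * ((m : ℝ) + 1) ^ r = (((m : ℝ) + 1) / q) ^ r := by
          rw [Real.div_rpow hm.le hq0.le, Real.rpow_neg hq0.le]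
          ring
      _ ≤ _ := Real.rpow_le_rpow (by positivity) hbase hr
  have hone : ((m : ℝ) + 1) ^ r * ((m : ℝ) + 1) ^ (-r) = 1 := by
    rw [← Real.rpow_add hm, add_neg_cancel, Real.rpow_zero]
  calc q ^ (-r) * (‖a m‖ * (ρ ^ q⁻¹) ^ m)
      = (q ^ (-r) * ((m : ℝ) + 1) ^ r * ρ ^ ((m : ℝ) / q)) *
          (((m : ℝ) + 1) ^ (-r) * ‖a m‖) := by
        rw [hρm]
        linear_combination (-(q ^ (-r) * ‖a m‖ * ρ ^ ((m : ℝ) / q))) * hone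
    _ ≤ ((1 + (m : ℝ) / q) ^ r * ρ ^ ((m : ℝ) / q)) * C := by
        gcongr
        exact hC m
    _ ≤ c * C := by
        gcongr
        exact hbound _ (by positivity)

/-- A bound on the weighted disk norms bounds the weighted coefficients. -/
theorem rpow_mul_weighted_coeff_le (hr : 0 ≤ r) (hρ : 0 < ρ) (hρ1 : ρ < 1) (ha : MemRL L a)
    (hC : ∀ n : ℕ, (p : ℝ) ^ (-(n : ℝ) * r) * diskNorm L a (ρ ^ (((p : ℝ) ^ n)⁻¹)) ≤ C) (m : ℕ) :
    ρ ^ (p : ℝ) * (((m : ℝ) + 1) ^ (-r) * ‖a m‖) ≤ C := by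
  have hp : 1 < p := (Fact.out : p.Prime).one_lt
  have hp0 : (0 : ℝ) < p := by positivity
  set n : ℕ := Nat.log p (m + 1)
  have hle : (p : ℝ) ^ n ≤ (m : ℝ) + 1 := by
    exact_mod_cast Nat.pow_log_le_self p m.succ_ne_zero
  have hlt : (m : ℝ) + 1 < (p : ℝ) ^ n * p := by
    rw [← pow_succ]
    exact_mod_cast Nat.lt_pow_succ_log_self hp (m + 1)
  have hCn := hC n
  have hpow : (p : ℝ) ^ (-(n : ℝ) * r) = ((p : ℝ) ^ n) ^ (-r) := by
    rw [← Real.rpow_natCast, ← Real.rpow_mul hp0.le]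
    ring_nf
  rw [hpow] at hCn
  set q : ℝ := (p : ℝ) ^ n
  have hq0 : 0 < q := by positivity
  have hbdd : BddAbove (Set.range fun k : ℕ => ‖a k‖ * (ρ ^ q⁻¹) ^ k) :=
    (ha _ (by positivity) (Real.rpow_lt_one hρ.le hρ1 (by positivity))).bddAbove_range
  have hcoeff : ‖a m‖ * (ρ ^ q⁻¹) ^ m ≤ diskNorm L a (ρ ^ q⁻¹) := le_ciSup hbdd m
  have hρm : (ρ ^ q⁻¹) ^ m = ρ ^ ((m : ℝ) / q) := by
    rw [← Real.rpow_natCast, ← Real.rpow_mul hρ.le]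
    ring_nf
  have hρp : ρ ^ (p : ℝ) ≤ (ρ ^ q⁻¹) ^ m := by
    rw [hρm]
    refine Real.rpow_le_rpow_of_exponent_ge hρ hρ1.le ?_
    rw [div_le_iff₀ hq0]
    linarith
  calc ρ ^ (p : ℝ) * (((m : ℝ) + 1) ^ (-r) * ‖a m‖)
      ≤ (ρ ^ q⁻¹) ^ m * (q ^ (-r) * ‖a m‖) := by
        gcongr ?_ * (?_ * _)
        exact Real.rpow_le_rpow_of_nonpos hq0 hle (neg_nonpos.2 hr)
    _ = q ^ (-r) * (‖a m‖ * (ρ ^ q⁻¹) ^ m) := by ring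
    _ ≤ q ^ (-r) * diskNorm L a (ρ ^ q⁻¹) := by gcongr
    _ ≤ C := hCn

theorem ordBddAt_iff_weighted_coeff_bounded (hr : 0 ≤ r) (hρ : 0 < ρ) (hρ1 : ρ < 1)
    (ha : MemRL L a) :
    OrdBddAt p L r a ρ ↔ ∃ C : ℝ, ∀ n : ℕ, ((n : ℝ) + 1) ^ (-r) * ‖a n‖ ≤ C := by
  constructor
  · rintro ⟨C, hC⟩
    refine ⟨C / ρ ^ (p : ℝ), fun m => ?_⟩
    rw [le_div_iff₀' (by positivity)]
    exact rpow_mul_weighted_coeff_le hr hρ hρ1 ha hC m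
  · rintro ⟨C, hC⟩
    obtain ⟨c, -, hc⟩ := exists_weighted_diskNorm_le p L hr hρ hρ1
    exact ⟨c * C, hc a C hC⟩

end Bounds

/-- (i) For every `ρ ∈ (0,1)`, `(p^{-nr} ‖w‖_{D(0,ρ^{1/pⁿ})})ₙ` is bounded iff
`((n+1)^{-r} ‖aₙ‖)ₙ` is bounded; in particular boundedness for one `ρ` implies
boundedness for all `ρ`.  (ii) For each `ρ ∈ (0,1)` there are `c₁, c₂ > 0` such
that for every `w ∈ R_L^+` of order `r`,
`c₁ sup_n (n+1)^{-r}‖aₙ‖ ≤ sup_n p^{-nr}‖w‖_{D(0,ρ^{1/pⁿ})} ≤ c₂ sup_n (n+1)^{-r}‖aₙ‖`. -/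
theorem statement3 (p : ℕ) [Fact p.Prime] (L : Type) [NontriviallyNormedField L]
    [NormedAlgebra ℚ_[p] L] [FiniteDimensional ℚ_[p] L] [IsUltrametricDist L]
    (r : ℝ) (hr : 0 ≤ r) :
    (∀ a : ℕ → L, MemRL L a → ∀ ρ : ℝ, 0 < ρ → ρ < 1 →
      (OrdBddAt p L r a ρ ↔ ∃ C : ℝ, ∀ n : ℕ, ((n : ℝ) + 1) ^ (-r) * ‖a n‖ ≤ C)) ∧
    (∀ a : ℕ → L, MemRL L a → ∀ ρ₁ ρ₂ : ℝ, 0 < ρ₁ → ρ₁ < 1 → 0 < ρ₂ → ρ₂ < 1 →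
      OrdBddAt p L r a ρ₁ → OrdBddAt p L r a ρ₂) ∧
    (∀ ρ : ℝ, 0 < ρ → ρ < 1 → ∃ c₁ : ℝ, 0 < c₁ ∧ ∃ c₂ : ℝ, 0 < c₂ ∧
      ∀ a : ℕ → L, MemRL L a → IsOrder p L r a →
        c₁ * (⨆ n : ℕ, ((n : ℝ) + 1) ^ (-r) * ‖a n‖) ≤
            (⨆ n : ℕ, (p : ℝ) ^ (-(n : ℝ) * r) * diskNorm L a (ρ ^ (((p : ℝ) ^ n)⁻¹))) ∧
          (⨆ n : ℕ, (p : ℝ) ^ (-(n : ℝ) * r) * diskNorm L a (ρ ^ (((p : ℝ) ^ n)⁻¹))) ≤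
            c₂ * (⨆ n : ℕ, ((n : ℝ) + 1) ^ (-r) * ‖a n‖)) := by
  refine ⟨fun a ha ρ hρ hρ1 => ordBddAt_iff_weighted_coeff_bounded hr hρ hρ1 ha,
    fun a ha ρ₁ ρ₂ h₁ h₁' h₂ h₂' h => ?_, fun ρ hρ hρ1 => ?_⟩
  · rw [ordBddAt_iff_weighted_coeff_bounded hr h₂ h₂' ha]
    exact (ordBddAt_iff_weighted_coeff_bounded hr h₁ h₁' ha).1 h
  · obtain ⟨c, hc0, hc⟩ := exists_weighted_diskNorm_le p L hr hρ hρ1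
    refine ⟨ρ ^ (p : ℝ), by positivity, c, hc0, fun a ha ⟨σ, hσ, hσ1, hord⟩ => ?_⟩
    have hcoeff := (ordBddAt_iff_weighted_coeff_bounded hr hσ hσ1 ha).1 hord
    obtain ⟨B, hB⟩ := (ordBddAt_iff_weighted_coeff_bounded (p := p) hr hρ hρ1 ha).2 hcoeff
    obtain ⟨A, hA⟩ := hcoeff
    have hcoeffBdd : BddAbove (Set.range fun n : ℕ => ((n : ℝ) + 1) ^ (-r) * ‖a n‖) :=
      ⟨A, Set.forall_mem_range.2 hA⟩
    have hnormBdd : BddAbove (Set.range fun n : ℕ =>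
        (p : ℝ) ^ (-(n : ℝ) * r) * diskNorm L a (ρ ^ (((p : ℝ) ^ n)⁻¹))) :=
      ⟨B, Set.forall_mem_range.2 hB⟩
    constructor
    · rw [Real.mul_iSup_of_nonneg (by positivity)]
      exact ciSup_le (rpow_mul_weighted_coeff_le hr hρ hρ1 ha (le_ciSup hnormBdd))
    · exact ciSup_le (hc a _ (le_ciSup hcoeffBdd))

end Paper

end
end

section
/- Let r ∈ ℝ≥0. (i) Each binomial function z ↦ binom(z,n) lies in C^r(ℤ_p, L), and the map μ ↦ (μ(z ↦ binom(z,n)))_{n≥0} is an L-linear bijection from the continuous dual C^r(ℤ_p, L)* onto the space of sequences (b_n)_{n≥0} in L such that ((n+1)^{−r}|b_n|)_{n≥0} is bounded. (ii) ‖μ‖'_r := sup_{n≥0} (n+1)^{−r} |μ(z ↦ binom(z,n))| is a norm on C^r(ℤ_p, L)* equivalent to the operator norm. -/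
open Filter Topology Classical

noncomputable section

namespace Paper

variable (p : ℕ) [Fact p.Prime]
variable (L : Type) [NontriviallyNormedField L] [NormedAlgebra ℚ_[p] L]

/-- The binomial function `z ↦ binom(z, n)`, viewed with values in `L`. -/
noncomputable def binomFun (n : ℕ) : ℤ_[p] → L := fun z => iotaL p L (binomQ p z n)

/-- The operator norm of a continuous linear functional on `C^r(ℤ_p, L)`. -/
noncomputable def opNorm (r : ℝ) (μ : CrDual p L r) : ℝ :=
  ⨆ f : {f : ℤ_[p] → L // IsCr p L r f ∧ crNorm p L r f ≤ 1}, ‖μ.toFun f‖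

variable {p L}

theorem binomFun_natCast (m n : ℕ) : binomFun p L m (n : ℤ_[p]) = (n.choose m : L) := by
  have h : binomQ p (n : ℤ_[p]) m = (n.choose m : ℚ_[p]) := by
    rw [binomQ, PadicInt.coe_natCast, ← descPochhammer_eval_eq_prod_range,
      descPochhammer_eval_eq_descFactorial, Nat.descFactorial_eq_factorial_mul_choose,
      Nat.cast_mul, mul_div_cancel_left₀]
    exact_mod_cast m.factorial_ne_zero
  rw [binomFun, h, iotaL, map_natCast]

theorem mahlerCoeff_binomFun (m n : ℕ) :
    mahlerCoeff p L (binomFun p L m) n = if n = m then 1 else 0 := by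
  have h := congrArg (Int.cast : ℤ → L) (fwdDiff_iter_choose_zero m n)
  rw [fwdDiff_iter_eq_sum_shift] at h
  push_cast at h
  rw [← h, mahlerCoeff, ← Finset.sum_range_reflect]
  refine Finset.sum_congr rfl fun j hj => ?_
  have hj' : j ≤ n := Nat.lt_succ_iff.1 (Finset.mem_range.1 hj)
  rw [binomFun_natCast, show n + 1 - 1 - j = n - j by omega, Nat.choose_symm hj',
    Nat.sub_sub_self hj']
  simp

theorem mahlerCoeff_add {p : ℕ} [Fact p.Prime] {L : Type} [NontriviallyNormedField L]
    (f g : ℤ_[p] → L) (n : ℕ) :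
    mahlerCoeff p L (f + g) n = mahlerCoeff p L f n + mahlerCoeff p L g n := by
  simp only [mahlerCoeff, Pi.add_apply, mul_add, Finset.sum_add_distrib]

theorem mahlerCoeff_smul {p : ℕ} [Fact p.Prime] {L : Type} [NontriviallyNormedField L]
    (c : L) (f : ℤ_[p] → L) (n : ℕ) :
    mahlerCoeff p L (c • f) n = c * mahlerCoeff p L f n := by
  simp only [mahlerCoeff, Pi.smul_apply, smul_eq_mul, Finset.mul_sum]
  exact Finset.sum_congr rfl fun i _ => by ring

variable {r : ℝ} {f g : ℤ_[p] → L}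

theorem IsCr.add (hf : IsCr p L r f) (hg : IsCr p L r g) : IsCr p L r (f + g) := by
  refine ⟨?_, fun z => ?_⟩
  · refine squeeze_zero (fun n => by positivity) (fun n => ?_)
      (by simpa using hf.1.add hg.1)
    rw [mahlerCoeff_add, ← mul_add]
    exact mul_le_mul_of_nonneg_left (norm_add_le _ _) (by positivity)
  · simpa only [mahlerCoeff_add, add_mul, Pi.add_apply] using (hf.2 z).add (hg.2 z)

theorem IsCr.smul (c : L) (hf : IsCr p L r f) : IsCr p L r (c • f) := by
  refine ⟨?_, fun z => ?_⟩
  · have h := hf.1.const_mul ‖c‖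
    rw [mul_zero] at h
    refine h.congr fun n => ?_
    rw [mahlerCoeff_smul, norm_mul]
    ring
  · simpa only [mahlerCoeff_smul, mul_assoc, Pi.smul_apply, smul_eq_mul] using (hf.2 z).mul_left c

theorem isCr_binomFun (r : ℝ) (m : ℕ) : IsCr p L r (binomFun p L m) := by
  refine ⟨tendsto_const_nhds.congr' ?_, fun z => ?_⟩
  · filter_upwards [eventually_gt_atTop m] with n hn
    simp [mahlerCoeff_binomFun, hn.ne']
  · have h := hasSum_single
      (f := fun n => mahlerCoeff p L (binomFun p L m) n * iotaL p L (binomQ p z n)) m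
      fun n hn => by simp [mahlerCoeff_binomFun, hn]
    simpa only [mahlerCoeff_binomFun, if_true, one_mul, binomFun] using h

theorem isCr_zero : IsCr p L r 0 := by
  simpa using (isCr_binomFun (p := p) (L := L) r 0).smul 0

theorem IsCr.tendsto_weighted (hr : 0 ≤ r) (hf : IsCr p L r f) :
    Tendsto (fun n : ℕ => ((n : ℝ) + 1) ^ r * ‖mahlerCoeff p L f n‖) atTop (𝓝 0) := by
  have h := hf.1.const_mul ((2 : ℝ) ^ r)
  rw [mul_zero] at h
  refine squeeze_zero' (.of_forall fun n => by positivity) ?_ h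
  filter_upwards [eventually_ge_atTop 1] with n hn
  have hn' : (1 : ℝ) ≤ n := by exact_mod_cast hn
  rw [← mul_assoc, ← Real.mul_rpow (by norm_num) (by positivity)]
  exact mul_le_mul_of_nonneg_right
    (Real.rpow_le_rpow (by positivity) (by linarith) hr) (norm_nonneg _)

theorem IsCr.weighted_le_crNorm (hr : 0 ≤ r) (hf : IsCr p L r f) (n : ℕ) :
    ((n : ℝ) + 1) ^ r * ‖mahlerCoeff p L f n‖ ≤ crNorm p L r f :=
  le_ciSup (hf.tendsto_weighted hr).bddAbove_range n

theorem crNorm_nonneg {p : ℕ} [Fact p.Prime] {L : Type} [NontriviallyNormedField L]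
    (r : ℝ) (f : ℤ_[p] → L) : 0 ≤ crNorm p L r f :=
  Real.iSup_nonneg fun _ => by positivity

theorem crNorm_smul_binomFun_le (r : ℝ) (c : L) (m : ℕ) :
    crNorm p L r (c • binomFun p L m) ≤ ‖c‖ * ((m : ℝ) + 1) ^ r := by
  refine ciSup_le fun n => ?_
  rw [mahlerCoeff_smul, mahlerCoeff_binomFun]
  split_ifs with h
  · subst h
    simp [mul_comm]
  · simp only [mul_zero, norm_zero]
    positivity

/-- The truncation of the Mahler expansion of `f` to its first `N` terms. -/
def mahlerPartialSum (f : ℤ_[p] → L) (N : ℕ) : ℤ_[p] → L :=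
  ∑ n ∈ Finset.range N, mahlerCoeff p L f n • binomFun p L n

theorem mahlerPartialSum_succ (f : ℤ_[p] → L) (N : ℕ) :
    mahlerPartialSum f (N + 1) =
      mahlerPartialSum f N + mahlerCoeff p L f N • binomFun p L N :=
  Finset.sum_range_succ _ _

theorem isCr_mahlerPartialSum (r : ℝ) (f : ℤ_[p] → L) (N : ℕ) :
    IsCr p L r (mahlerPartialSum f N) := by
  induction N with
  | zero => exact isCr_zero
  | succ N ih =>
    rw [mahlerPartialSum_succ]
    exact ih.add ((isCr_binomFun r N).smul _)

theorem mahlerCoeff_mahlerPartialSum (f : ℤ_[p] → L) (N n : ℕ) :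
    mahlerCoeff p L (mahlerPartialSum f N) n = if n < N then mahlerCoeff p L f n else 0 := by
  induction N with
  | zero => simp [mahlerPartialSum, mahlerCoeff]
  | succ N ih =>
    rw [mahlerPartialSum_succ, mahlerCoeff_add, mahlerCoeff_smul, mahlerCoeff_binomFun, ih]
    rcases lt_trichotomy n N with h | rfl | h
    · simp [h, h.ne, h.trans N.lt_succ_self]
    · simp
    · simp [h.not_gt, h.ne', show ¬ n < N + 1 by omega]

namespace CrDual

variable (μ : CrDual p L r)

theorem map_mahlerPartialSum (f : ℤ_[p] → L) (N : ℕ) :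
    μ.toFun (mahlerPartialSum f N) =
      ∑ n ∈ Finset.range N, mahlerCoeff p L f n * μ.toFun (binomFun p L n) := by
  induction N with
  | zero =>
    simpa [mahlerPartialSum] using μ.map_smul' 0 0 isCr_zero
  | succ N ih =>
    rw [mahlerPartialSum_succ,
      μ.map_add' _ _ (isCr_mahlerPartialSum r f N) ((isCr_binomFun r N).smul _),
      μ.map_smul' _ _ (isCr_binomFun r N), Finset.sum_range_succ, ← ih]

/-- A continuous functional is determined by its values on binomials, through the Mahler
expansion. -/
theorem tendsto_sum (hr : 0 ≤ r) (hf : IsCr p L r f) :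
    Tendsto (fun N => ∑ n ∈ Finset.range N, mahlerCoeff p L f n * μ.toFun (binomFun p L n))
      atTop (𝓝 (μ.toFun f)) := by
  obtain ⟨C, hC⟩ := μ.bound'
  have hR (N : ℕ) : IsCr p L r (f + (-1 : L) • mahlerPartialSum f N) :=
    hf.add ((isCr_mahlerPartialSum r f N).smul _)
  have hcr : Tendsto (fun N => crNorm p L r (f + (-1 : L) • mahlerPartialSum f N))
      atTop (𝓝 0) := by
    refine Metric.tendsto_atTop.2 fun ε hε => ?_
    obtain ⟨N₀, hN₀⟩ := eventually_atTop.1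
      ((hf.tendsto_weighted hr).eventually_le_const (half_pos hε))
    refine ⟨N₀, fun N hN => ?_⟩
    rw [Real.dist_0_eq_abs, abs_of_nonneg (crNorm_nonneg _ _)]
    refine lt_of_le_of_lt (ciSup_le fun n => ?_) (half_lt_self hε)
    rw [mahlerCoeff_add, mahlerCoeff_smul, mahlerCoeff_mahlerPartialSum]
    split_ifs with h
    · simpa using (half_pos hε).le
    · simpa using hN₀ n (by omega)
  rw [tendsto_iff_norm_sub_tendsto_zero]
  refine squeeze_zero (fun _ => norm_nonneg _) (fun N => ?_)
    (by simpa only [mul_zero] using hcr.const_mul C)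
  refine le_trans (le_of_eq ?_) (hC _ (hR N))
  rw [μ.map_add' _ _ hf ((isCr_mahlerPartialSum r f N).smul _),
    μ.map_smul' _ _ (isCr_mahlerPartialSum r f N), map_mahlerPartialSum, norm_sub_rev]
  congr 1
  ring

theorem exists_weighted_le :
    ∃ C : ℝ, ∀ n : ℕ, ((n : ℝ) + 1) ^ (-r) * ‖μ.toFun (binomFun p L n)‖ ≤ C := by
  obtain ⟨C, hC⟩ := μ.bound'
  refine ⟨max C 0, fun n => ?_⟩
  have hn : (0 : ℝ) < ((n : ℝ) + 1) ^ r := by positivity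
  have h₁ : crNorm p L r (binomFun p L n) ≤ ((n : ℝ) + 1) ^ r := by
    simpa using crNorm_smul_binomFun_le (p := p) (L := L) r 1 n
  rw [Real.rpow_neg (by positivity), inv_mul_le_iff₀ hn, mul_comm _ (max C 0)]
  calc ‖μ.toFun (binomFun p L n)‖ ≤ C * crNorm p L r (binomFun p L n) := hC _ (isCr_binomFun r n)
    _ ≤ max C 0 * crNorm p L r (binomFun p L n) :=
      mul_le_mul_of_nonneg_right (le_max_left _ _) (crNorm_nonneg _ _)
    _ ≤ max C 0 * ((n : ℝ) + 1) ^ r := mul_le_mul_of_nonneg_left h₁ (le_max_right _ _)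

theorem weighted_le_iSup (n : ℕ) :
    ((n : ℝ) + 1) ^ (-r) * ‖μ.toFun (binomFun p L n)‖ ≤
      ⨆ n : ℕ, ((n : ℝ) + 1) ^ (-r) * ‖μ.toFun (binomFun p L n)‖ :=
  let ⟨C, hC⟩ := μ.exists_weighted_le
  le_ciSup (f := fun n : ℕ => ((n : ℝ) + 1) ^ (-r) * ‖μ.toFun (binomFun p L n)‖)
    ⟨C, Set.forall_mem_range.2 hC⟩ n

end CrDual

theorem norm_mul_le_of_weighted_le {b : ℕ → L} {C : ℝ}
    (hb : ∀ n : ℕ, ((n : ℝ) + 1) ^ (-r) * ‖b n‖ ≤ C) (a : L) (n : ℕ) :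
    ‖a * b n‖ ≤ C * (((n : ℝ) + 1) ^ r * ‖a‖) := by
  have hn : (0 : ℝ) < ((n : ℝ) + 1) ^ r := by positivity
  have h := hb n
  rw [Real.rpow_neg (by positivity), inv_mul_le_iff₀ hn] at h
  rw [norm_mul]
  calc ‖a‖ * ‖b n‖ ≤ ‖a‖ * (((n : ℝ) + 1) ^ r * C) := mul_le_mul_of_nonneg_left h (norm_nonneg _)
    _ = _ := by ring

theorem nonneg_of_weighted_le {b : ℕ → L} {C : ℝ}
    (hb : ∀ n : ℕ, ((n : ℝ) + 1) ^ (-r) * ‖b n‖ ≤ C) : 0 ≤ C :=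
  le_trans (by positivity) (hb 0)

theorem IsCr.norm_sum_mul_le [IsUltrametricDist L] (hr : 0 ≤ r) (hf : IsCr p L r f) {b : ℕ → L}
    {C : ℝ} (hb : ∀ n : ℕ, ((n : ℝ) + 1) ^ (-r) * ‖b n‖ ≤ C) (N : ℕ) :
    ‖∑ n ∈ Finset.range N, mahlerCoeff p L f n * b n‖ ≤ C * crNorm p L r f := by
  have hC := nonneg_of_weighted_le hb
  exact IsUltrametricDist.norm_sum_le_of_forall_le_of_nonneg
    (mul_nonneg hC (crNorm_nonneg _ _)) fun n _ =>
      (norm_mul_le_of_weighted_le hb _ n).trans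
        (mul_le_mul_of_nonneg_left (hf.weighted_le_crNorm hr n) hC)

theorem IsCr.summable_mul [IsUltrametricDist L] [CompleteSpace L] (hr : 0 ≤ r)
    (hf : IsCr p L r f) {b : ℕ → L} {C : ℝ}
    (hb : ∀ n : ℕ, ((n : ℝ) + 1) ^ (-r) * ‖b n‖ ≤ C) :
    Summable fun n => mahlerCoeff p L f n * b n := by
  refine NonarchimedeanAddGroup.summable_of_tendsto_cofinite_zero ?_
  rw [Nat.cofinite_eq_atTop, tendsto_zero_iff_norm_tendsto_zero]
  exact squeeze_zero (fun _ => norm_nonneg _) (fun n => norm_mul_le_of_weighted_le hb _ n)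
    (by simpa using (hf.tendsto_weighted hr).const_mul C)

/-- The functional `f ↦ ∑ aₙ(f) bₙ` attached to a sequence of growth order `r`. -/
def CrDual.ofSeq [IsUltrametricDist L] [CompleteSpace L] (hr : 0 ≤ r) (b : ℕ → L)
    (hb : ∃ C : ℝ, ∀ n : ℕ, ((n : ℝ) + 1) ^ (-r) * ‖b n‖ ≤ C) : CrDual p L r where
  toFun f := ∑' n, mahlerCoeff p L f n * b n
  map_add' f g hf hg := by
    obtain ⟨C, hC⟩ := hb
    simp only [mahlerCoeff_add, add_mul]
    exact (hf.summable_mul hr hC).tsum_add (hg.summable_mul hr hC)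
  map_smul' c f _ := by
    simp only [mahlerCoeff_smul, mul_assoc, tsum_mul_left]
  bound' := by
    obtain ⟨C, hC⟩ := hb
    exact ⟨C, fun f hf => le_of_tendsto (hf.summable_mul hr hC).hasSum.tendsto_sum_nat.norm
      (.of_forall fun N => hf.norm_sum_mul_le hr hC N)⟩

theorem CrDual.ofSeq_binomFun [IsUltrametricDist L] [CompleteSpace L] (hr : 0 ≤ r) (b : ℕ → L)
    (hb : ∃ C : ℝ, ∀ n : ℕ, ((n : ℝ) + 1) ^ (-r) * ‖b n‖ ≤ C) (m : ℕ) :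
    (CrDual.ofSeq (p := p) hr b hb).toFun (binomFun p L m) = b m := by
  simp [ofSeq, mahlerCoeff_binomFun]

namespace CrDual

variable (μ : CrDual p L r)

theorem norm_apply_le [IsUltrametricDist L] (hr : 0 ≤ r) (hf : IsCr p L r f) :
    ‖μ.toFun f‖ ≤
      (⨆ n : ℕ, ((n : ℝ) + 1) ^ (-r) * ‖μ.toFun (binomFun p L n)‖) * crNorm p L r f :=
  le_of_tendsto (μ.tendsto_sum hr hf).norm
    (.of_forall fun N => hf.norm_sum_mul_le hr μ.weighted_le_iSup N)

theorem iSup_nonneg : 0 ≤ ⨆ n : ℕ, ((n : ℝ) + 1) ^ (-r) * ‖μ.toFun (binomFun p L n)‖ :=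
  Real.iSup_nonneg fun _ => by positivity

theorem norm_apply_le_iSup [IsUltrametricDist L] (hr : 0 ≤ r)
    (f : {f : ℤ_[p] → L // IsCr p L r f ∧ crNorm p L r f ≤ 1}) :
    ‖μ.toFun f‖ ≤ ⨆ n : ℕ, ((n : ℝ) + 1) ^ (-r) * ‖μ.toFun (binomFun p L n)‖ :=
  (μ.norm_apply_le hr f.2.1).trans (mul_le_of_le_one_right μ.iSup_nonneg f.2.2)

theorem opNorm_le_iSup [IsUltrametricDist L] (hr : 0 ≤ r) :
    opNorm p L r μ ≤ ⨆ n : ℕ, ((n : ℝ) + 1) ^ (-r) * ‖μ.toFun (binomFun p L n)‖ :=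
  Real.iSup_le (μ.norm_apply_le_iSup hr) μ.iSup_nonneg

theorem iSup_le_mul_opNorm [IsUltrametricDist L] (hr : 0 ≤ r) {ϖ : L} (hϖ : 1 < ‖ϖ‖) :
    (⨆ n : ℕ, ((n : ℝ) + 1) ^ (-r) * ‖μ.toFun (binomFun p L n)‖) ≤ ‖ϖ‖ * opNorm p L r μ := by
  refine ciSup_le fun n => ?_
  have hn : (0 : ℝ) < ((n : ℝ) + 1) ^ r := by positivity
  obtain ⟨m, hm₁, hm₂⟩ := exists_mem_Ico_zpow (inv_pos.2 hn) hϖ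
  have hc : crNorm p L r (ϖ ^ m • binomFun p L n) ≤ 1 := by
    refine (crNorm_smul_binomFun_le r _ n).trans ?_
    rw [norm_zpow]
    exact (mul_le_mul_of_nonneg_right hm₁ hn.le).trans_eq (inv_mul_cancel₀ hn.ne')
  have hop : ‖μ.toFun (ϖ ^ m • binomFun p L n)‖ ≤ opNorm p L r μ :=
    le_ciSup (f := fun f : {f : ℤ_[p] → L // IsCr p L r f ∧ crNorm p L r f ≤ 1} => ‖μ.toFun f‖)
      ⟨_, Set.forall_mem_range.2 (μ.norm_apply_le_iSup hr)⟩
      ⟨_, (isCr_binomFun r n).smul (ϖ ^ m), hc⟩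
  rw [μ.map_smul' _ _ (isCr_binomFun r n), norm_mul, norm_zpow] at hop
  rw [Real.rpow_neg (by positivity)]
  calc (((n : ℝ) + 1) ^ r)⁻¹ * ‖μ.toFun (binomFun p L n)‖
      ≤ ‖ϖ‖ ^ (m + 1) * ‖μ.toFun (binomFun p L n)‖ :=
        mul_le_mul_of_nonneg_right hm₂.le (norm_nonneg _)
    _ = ‖ϖ‖ * (‖ϖ‖ ^ m * ‖μ.toFun (binomFun p L n)‖) := by
        rw [zpow_add_one₀ (by positivity)]
        ring
    _ ≤ ‖ϖ‖ * opNorm p L r μ := mul_le_mul_of_nonneg_left hop (norm_nonneg _)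

end CrDual

/-- (i) Each `z ↦ binom(z,n)` is in `C^r(ℤ_p, L)` and `μ ↦ (μ(binom(·,n)))ₙ` is an
`L`-linear bijection from `C^r(ℤ_p,L)*` onto the sequences `b` with
`((n+1)^{-r}‖bₙ‖)ₙ` bounded.  (ii) `‖μ‖'_r = sup_n (n+1)^{-r} ‖μ(binom(·,n))‖`
is a norm on `C^r(ℤ_p,L)*` equivalent to the operator norm. -/
theorem statement4 (p : ℕ) [Fact p.Prime] (L : Type) [NontriviallyNormedField L]
    [NormedAlgebra ℚ_[p] L] [FiniteDimensional ℚ_[p] L] [IsUltrametricDist L]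
    (r : ℝ) (hr : 0 ≤ r) :
    (∀ n : ℕ, IsCr p L r (binomFun p L n)) ∧
    (∀ μ : CrDual p L r, ∃ C : ℝ, ∀ n : ℕ,
        ((n : ℝ) + 1) ^ (-r) * ‖μ.toFun (binomFun p L n)‖ ≤ C) ∧
    (∀ μ₁ μ₂ : CrDual p L r,
        (∀ n : ℕ, μ₁.toFun (binomFun p L n) = μ₂.toFun (binomFun p L n)) →
        ∀ f : ℤ_[p] → L, IsCr p L r f → μ₁.toFun f = μ₂.toFun f) ∧
    (∀ b : ℕ → L, (∃ C : ℝ, ∀ n : ℕ, ((n : ℝ) + 1) ^ (-r) * ‖b n‖ ≤ C) →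
        ∃ μ : CrDual p L r, ∀ n : ℕ, μ.toFun (binomFun p L n) = b n) ∧
    (∀ μ : CrDual p L r,
        ((⨆ n : ℕ, ((n : ℝ) + 1) ^ (-r) * ‖μ.toFun (binomFun p L n)‖) = 0 ↔
          ∀ f : ℤ_[p] → L, IsCr p L r f → μ.toFun f = 0)) ∧
    (∃ c₁ : ℝ, 0 < c₁ ∧ ∃ c₂ : ℝ, 0 < c₂ ∧ ∀ μ : CrDual p L r,
        c₁ * opNorm p L r μ ≤
            (⨆ n : ℕ, ((n : ℝ) + 1) ^ (-r) * ‖μ.toFun (binomFun p L n)‖) ∧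
          (⨆ n : ℕ, ((n : ℝ) + 1) ^ (-r) * ‖μ.toFun (binomFun p L n)‖) ≤
            c₂ * opNorm p L r μ) := by
  have : CompleteSpace L := FiniteDimensional.complete ℚ_[p] L
  obtain ⟨ϖ, hϖ⟩ := NormedField.exists_one_lt_norm L
  refine ⟨isCr_binomFun r, fun μ => μ.exists_weighted_le, fun μ₁ μ₂ h f hf => ?_,
    fun b hb => ⟨CrDual.ofSeq hr b hb, CrDual.ofSeq_binomFun hr b hb⟩, fun μ => ⟨?_, ?_⟩,
    1, one_pos, ‖ϖ‖, one_pos.trans hϖ, fun μ => ⟨?_, μ.iSup_le_mul_opNorm hr hϖ⟩⟩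
  · have h₁ := μ₁.tendsto_sum hr hf
    simp only [h] at h₁
    exact tendsto_nhds_unique h₁ (μ₂.tendsto_sum hr hf)
  · intro h f hf
    have := μ.norm_apply_le hr hf
    rwa [h, zero_mul, norm_le_zero_iff] at this
  · intro h
    simp [h _ (isCr_binomFun r _)]
  · rw [one_mul]
    exact μ.opNorm_le_iSup hr

end Paper

end
end
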